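/- arXiv:1910.10955 — 4 statements merged into one kernel-verified Lean document; each statement's English description precedes it below -/
import Mathlib

section
/- Let s > 1/2. For λ ∈ ℂ and k ∈ ℕ let p_{λ,k}(x) = k! · Σ_{m=0}^{⌊k/2⌋} x^{k−2m} λ^{k−m} / (m! (k−2m)! 2^m), so that ∂^k (exp(λ x²/2)) = p_{λ,k}(x) exp(λ x²/2). Then for each μ > 0 there exists δ with 0 < δ ≤ 1 such that for every h > 0 there is a constant C > 0 with the property: for all λ ∈ ℂ with |λ| ≤ δ, all k ∈ ℕ and all x ∈ ℝ, |p_{λ,k}(x)| ≤ C h^k (k!)^s exp(μ h^{−1/s} |x|^{1/s}). -/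
open scoped Nat

lemma gpe_pow_le (s : ℝ) (hs : 0 < s) (y : ℝ) (hy : 0 ≤ y) (j : ℕ) :
    y ^ j ≤ (j ! : ℝ) ^ s * Real.exp (s * y ^ (1 / s)) := by
  have hz : 0 ≤ y ^ (1 / s) := Real.rpow_nonneg hy _
  have h1 := Real.pow_div_factorial_le_exp (y ^ (1 / s)) hz j
  have hf : (0 : ℝ) < (j ! : ℝ) := by positivity
  rw [div_le_iff₀ hf] at h1
  have h2 := Real.rpow_le_rpow (by positivity) h1 hs.le
  rw [Real.mul_rpow (Real.exp_pos _).le hf.le, ← Real.exp_mul, ← Real.rpow_natCast,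
    ← Real.rpow_mul hy, ← Real.rpow_mul hy] at h2
  have h3 : 1 / s * (j : ℝ) * s = j := by field_simp
  rw [h3, Real.rpow_natCast] at h2
  calc y ^ j ≤ _ := h2
    _ = _ := by rw [mul_comm, mul_comm s]

lemma gpe_fact (j m : ℕ) :
    ((j + 2 * m)! : ℝ) ≤ (j ! : ℝ) * (2 ^ j * 16 ^ m * (m ! : ℝ) ^ 2) := by
  have h1 : (j + 2 * m)! = (j + 2 * m).choose j * j ! * (2 * m)! := by
    rw [Nat.choose_symm_add, Nat.add_choose_mul_factorial_mul_factorial]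
  have h2 : (2 * m)! = (2 * m).choose m * m ! * m ! := by
    rw [two_mul, Nat.add_choose_mul_factorial_mul_factorial]
  have h3 : (j + 2 * m).choose j ≤ 2 ^ (j + 2 * m) := Nat.choose_le_two_pow _ _
  have h4 : (2 * m).choose m ≤ 2 ^ (2 * m) := Nat.choose_le_two_pow _ _
  have : (j + 2 * m)! ≤ j ! * (2 ^ j * 16 ^ m * m ! ^ 2) := by
    rw [h1, h2]
    calc _ ≤ 2 ^ (j + 2 * m) * j ! * (2 ^ (2 * m) * m ! * m !) := by gcongr
      _ = _ := by
        rw [pow_add, pow_mul, show 16 = 2 ^ 2 * 2 ^ 2 by norm_num, mul_pow]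
        ring
  exact_mod_cast this

lemma gpe_ratio (s : ℝ) (hs0 : 0 ≤ s) (j m : ℕ) :
    ((j + 2 * m)! : ℝ) / (j ! : ℝ) * (j ! : ℝ) ^ s ≤
      ((j + 2 * m)! : ℝ) ^ s * (2 ^ j * 16 ^ m * (m ! : ℝ) ^ (1 - min (2 * s - 1) 1)) := by
  have hj : (0 : ℝ) < (j ! : ℝ) := by positivity
  have hk : (0 : ℝ) < ((j + 2 * m)! : ℝ) := by positivity
  have hm : (1 : ℝ) ≤ (m ! : ℝ) := by exact_mod_cast Nat.factorial_pos m
  set r : ℝ := ((j + 2 * m)! : ℝ) / (j ! : ℝ) with hr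
  have hr1 : 1 ≤ r := by
    rw [hr, one_le_div hj]
    exact_mod_cast Nat.factorial_le (by omega)
  have hr0 : 0 < r := by linarith
  have hkr : ((j + 2 * m)! : ℝ) = r * (j ! : ℝ) := by rw [hr]; field_simp
  have hP : (1 : ℝ) ≤ 2 ^ j * 16 ^ m :=
    one_le_mul_of_one_le_of_one_le (one_le_pow₀ (by norm_num)) (one_le_pow₀ (by norm_num))
  have key : r ^ (1 - s) ≤ 2 ^ j * 16 ^ m * (m ! : ℝ) ^ (1 - min (2 * s - 1) 1) := by
    rcases le_total 1 s with h | h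
    · rw [min_eq_right (by linarith), sub_self, Real.rpow_zero, mul_one]
      exact (Real.rpow_le_one_of_one_le_of_nonpos hr1 (by linarith)).trans hP
    · rw [min_eq_left (by linarith)]
      have h1 : r ≤ 2 ^ j * 16 ^ m * (m ! : ℝ) ^ 2 := by
        rw [hr, div_le_iff₀ hj]; linarith [gpe_fact j m]
      have h2 := Real.rpow_le_rpow hr0.le h1 (show 0 ≤ 1 - s by linarith)
      rw [Real.mul_rpow (by positivity) (by positivity), ← Real.rpow_natCast (m ! : ℝ) 2,
        ← Real.rpow_mul (by positivity)] at h2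
      have h3 : ((2 : ℕ) : ℝ) * (1 - s) = 1 - (2 * s - 1) := by push_cast; ring
      rw [h3] at h2
      refine h2.trans ?_
      gcongr
      calc ((2 : ℝ) ^ j * 16 ^ m) ^ (1 - s) ≤ ((2 : ℝ) ^ j * 16 ^ m) ^ (1 : ℝ) :=
              Real.rpow_le_rpow_of_exponent_le hP (by linarith)
          _ = _ := Real.rpow_one _
  rw [hkr, Real.mul_rpow hr0.le hj.le]
  have : r = r ^ s * r ^ (1 - s) := by
    rw [← Real.rpow_add hr0]; simp
  calc r * (j ! : ℝ) ^ s = r ^ s * (j ! : ℝ) ^ s * r ^ (1 - s) := by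
        conv_lhs => rw [this]
        ring
    _ ≤ _ := by gcongr

lemma gpe_term (s : ℝ) (hs : 1 / 2 < s) (μ : ℝ) (hμ : 0 < μ) (d h : ℝ) (hd0 : 0 ≤ d) (hd1 : d ≤ 1)
    (hd : 2 * (s / μ) ^ s * d ≤ 1) (hh : 0 < h) (x : ℝ) (j m : ℕ) :
    ((j + 2 * m)! : ℝ) * (|x| ^ j * d ^ (j + m) / ((m ! : ℝ) * (j ! : ℝ) * 2 ^ m)) ≤
      Real.exp (min (2 * s - 1) 1 * (32 / h ^ 2) ^ (1 / min (2 * s - 1) 1)) * h ^ (j + 2 * m) *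
        ((j + 2 * m)! : ℝ) ^ s * Real.exp (μ * h ^ (-(1 / s)) * |x| ^ (1 / s)) * (1 / 2) ^ m := by
  have hs0 : 0 < s := by linarith
  set t := min (2 * s - 1) 1 with ht
  have ht0 : 0 < t := lt_min (by linarith) one_pos
  set E := Real.exp (μ * h ^ (-(1 / s)) * |x| ^ (1 / s)) with hE
  set A := (s / μ) ^ s with hA
  have hA0 : 0 < A := by positivity
  have hm : (0 : ℝ) < (m ! : ℝ) := by positivity
  have hj : (0 : ℝ) < (j ! : ℝ) := by positivity
  have hx : |x| ^ j ≤ h ^ j * A ^ j * ((j ! : ℝ) ^ s * E) := by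
    have h1 := gpe_pow_le s hs0 (|x| / (h * A)) (by positivity) j
    have h2 : s * (|x| / (h * A)) ^ (1 / s) = μ * h ^ (-(1 / s)) * |x| ^ (1 / s) := by
      rw [Real.div_rpow (abs_nonneg x) (by positivity), Real.mul_rpow hh.le hA0.le, hA,
        ← Real.rpow_mul (by positivity), mul_one_div_cancel hs0.ne', Real.rpow_one,
        Real.rpow_neg hh.le]
      field_simp
    rw [h2, ← hE, div_pow, div_le_iff₀ (by positivity), mul_pow] at h1
    linarith
  have hC := gpe_pow_le t ht0 (32 / h ^ 2) (by positivity) m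
  set C0 := Real.exp (t * (32 / h ^ 2) ^ (1 / t))
  have hR := gpe_ratio s hs0.le j m
  rw [← ht] at hR
  set K : ℝ := ((j + 2 * m)! : ℝ) with hK
  have hK0 : 0 < K := by positivity
  have hdm : d ^ (j + m) ≤ d ^ j := pow_le_pow_of_le_one hd0 hd1 (by omega)
  have h2m : (1 : ℝ) ≤ 2 ^ m := one_le_pow₀ (by norm_num)
  have hsplit : (m ! : ℝ) ^ (1 - t) / (m ! : ℝ) = 1 / (m ! : ℝ) ^ t := by
    rw [Real.rpow_sub hm, Real.rpow_one]; field_simp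
  have hAd : (2 * A * d) ^ j ≤ 1 := pow_le_one₀ (by positivity) hd
  have hCm : (16 : ℝ) ^ m / (m ! : ℝ) ^ t ≤ C0 * (h ^ (2 * m)) * (1 / 2) ^ m := by
    rw [div_pow, div_le_iff₀ (by positivity)] at hC
    rw [div_le_iff₀ (by positivity), pow_mul, one_div, inv_pow]
    have : (32 : ℝ) ^ m = 16 ^ m * 2 ^ m := by rw [← mul_pow]; norm_num
    rw [this] at hC
    field_simp
    linarith
  calc K * (|x| ^ j * d ^ (j + m) / ((m ! : ℝ) * (j ! : ℝ) * 2 ^ m))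
      ≤ K * ((h ^ j * A ^ j * ((j ! : ℝ) ^ s * E)) * d ^ j / ((m ! : ℝ) * (j ! : ℝ) * 1)) := by
        gcongr
    _ = (K / (j ! : ℝ) * (j ! : ℝ) ^ s) * (h ^ j * A ^ j * E * d ^ j / (m ! : ℝ)) := by
        field_simp
    _ ≤ (K ^ s * (2 ^ j * 16 ^ m * (m ! : ℝ) ^ (1 - t))) *
          (h ^ j * A ^ j * E * d ^ j / (m ! : ℝ)) := by
        gcongr
    _ = K ^ s * h ^ j * E * (2 * A * d) ^ j * (16 ^ m * ((m ! : ℝ) ^ (1 - t) / (m ! : ℝ))) := by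
        rw [mul_pow, mul_pow]; ring
    _ = K ^ s * h ^ j * E * (2 * A * d) ^ j * (16 ^ m / (m ! : ℝ) ^ t) := by
        rw [hsplit]; ring
    _ ≤ K ^ s * h ^ j * E * 1 * (C0 * (h ^ (2 * m)) * (1 / 2) ^ m) := by
        gcongr
    _ = _ := by rw [pow_add]; ring

/-- Let `s > 1/2` and let
`p_{λ,k}(x) = k! · ∑_{m=0}^{⌊k/2⌋} x^{k−2m} λ^{k−m} / (m! (k−2m)! 2^m)` be the polynomial with
`∂^k (exp(λ x²/2)) = p_{λ,k}(x) exp(λ x²/2)`.  For each `μ > 0` there exists `0 < δ ≤ 1` such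
that for every `h > 0` there is `C > 0` with
`|p_{λ,k}(x)| ≤ C h^k (k!)^s exp(μ h^{−1/s} |x|^{1/s})` whenever `|λ| ≤ δ`, `k ∈ ℕ`, `x ∈ ℝ`. -/
theorem gaussian_polynomial_estimate (s : ℝ) (hs : 1 / 2 < s) (μ : ℝ) (hμ : 0 < μ) :
    ∃ δ : ℝ, 0 < δ ∧ δ ≤ 1 ∧
      ∀ h : ℝ, 0 < h → ∃ C : ℝ, 0 < C ∧
        ∀ (l : ℂ) (k : ℕ) (x : ℝ), ‖l‖ ≤ δ →
          ‖((k ! : ℂ) *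
              ∑ m ∈ Finset.range (k / 2 + 1),
                (x : ℂ) ^ (k - 2 * m) * l ^ (k - m) /
                  ((m ! : ℂ) * ((k - 2 * m)! : ℂ) * 2 ^ m))‖ ≤
            C * h ^ k * (k ! : ℝ) ^ s * Real.exp (μ * h ^ (-(1 / s)) * |x| ^ (1 / s)) := by
  have hs0 : 0 < s := by linarith
  have hA0 : 0 < (s / μ) ^ s := by positivity
  refine ⟨min 1 (1 / (2 * (s / μ) ^ s)), lt_min one_pos (by positivity), min_le_left _ _, ?_⟩
  intro h hh
  refine ⟨2 * Real.exp (min (2 * s - 1) 1 * (32 / h ^ 2) ^ (1 / min (2 * s - 1) 1)),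
    by positivity, ?_⟩
  intro l k x hl
  have hl1 : ‖l‖ ≤ 1 := hl.trans (min_le_left _ _)
  have hl2 : 2 * (s / μ) ^ s * ‖l‖ ≤ 1 := by
    have := hl.trans (min_le_right _ _)
    rw [le_div_iff₀ (by positivity)] at this
    linarith
  set C0 := Real.exp (min (2 * s - 1) 1 * (32 / h ^ 2) ^ (1 / min (2 * s - 1) 1))
  set E := Real.exp (μ * h ^ (-(1 / s)) * |x| ^ (1 / s))
  rw [norm_mul, Complex.norm_natCast]
  have hgeo : ∑ m ∈ Finset.range (k / 2 + 1), (1 / 2 : ℝ) ^ m ≤ 2 := sum_geometric_two_le _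
  calc (k ! : ℝ) * ‖∑ m ∈ Finset.range (k / 2 + 1),
                (x : ℂ) ^ (k - 2 * m) * l ^ (k - m) /
                  ((m ! : ℂ) * ((k - 2 * m)! : ℂ) * 2 ^ m)‖
      ≤ (k ! : ℝ) * ∑ m ∈ Finset.range (k / 2 + 1), ‖(x : ℂ) ^ (k - 2 * m) * l ^ (k - m) /
                  ((m ! : ℂ) * ((k - 2 * m)! : ℂ) * 2 ^ m)‖ := by
        gcongr
        exact norm_sum_le _ _
    _ = ∑ m ∈ Finset.range (k / 2 + 1), (k ! : ℝ) * ‖(x : ℂ) ^ (k - 2 * m) * l ^ (k - m) /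
                  ((m ! : ℂ) * ((k - 2 * m)! : ℂ) * 2 ^ m)‖ := Finset.mul_sum _ _ _
    _ ≤ ∑ m ∈ Finset.range (k / 2 + 1), C0 * h ^ k * (k ! : ℝ) ^ s * E * (1 / 2) ^ m := by
        refine Finset.sum_le_sum fun m hm => ?_
        rw [Finset.mem_range] at hm
        obtain ⟨j, rfl⟩ : ∃ j, k = j + 2 * m := ⟨k - 2 * m, by omega⟩
        have e1 : j + 2 * m - 2 * m = j := by omega
        have e2 : j + 2 * m - m = j + m := by omega
        rw [e1, e2]
        have := gpe_term s hs μ hμ ‖l‖ h (norm_nonneg l) hl1 hl2 hh x j m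
        simpa only [norm_div, norm_mul, norm_pow, Complex.norm_natCast, Complex.norm_real,
          Real.norm_eq_abs, Complex.norm_ofNat] using this
    _ = C0 * h ^ k * (k ! : ℝ) ^ s * E * ∑ m ∈ Finset.range (k / 2 + 1), (1 / 2 : ℝ) ^ m :=
        (Finset.mul_sum _ _ _).symm
    _ ≤ C0 * h ^ k * (k ! : ℝ) ^ s * E * 2 := by gcongr
    _ = _ := by ring
end

section
/- Let ε > 0, d ≥ 1, s > 1/2 and set μ = s · 2^{−4−3/(2s)} · d^{−1/(2s)}. Suppose a_t : ℝ^{2d} → ℂ, for 0 ≤ t ≤ ε, is a family of smooth functions such that for every h > 0 there is a constant C_h > 0 with |∂^α a_t(z)| ≤ C_h h^{|α|} (α!)^s exp(μ h^{−1/s} |z|^{1/s}) for all z ∈ ℝ^{2d}, α ∈ ℕ^{2d} and t ∈ [0,ε]. Let Φ : ℝ^{2d} → ℂ be smooth, not identically zero, and satisfy: for every A > 0 there is C_A > 0 with |∂^β Φ(x)| ≤ C_A (β!)^s A^{−|β|} exp(−A|x|^{1/s}) for all β ∈ ℕ^{2d} and x ∈ ℝ^{2d}. Then for every b > 0 there is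 a constant C > 0 such that |V_Φ a_t(z,ζ)| ≤ C exp((b/4)|z|^{1/s} − b|ζ|^{1/s}) for all z, ζ ∈ ℝ^{2d} and all t ∈ [0,ε]. -/
open scoped Nat
open MeasureTheory

/-- Partial derivative in the `j`-th coordinate direction. -/
noncomputable def pd {n : ℕ} (j : Fin n) (f : EuclideanSpace ℝ (Fin n) → ℂ) :
    EuclideanSpace ℝ (Fin n) → ℂ :=
  fun z => fderiv ℝ f z (EuclideanSpace.single j 1)

/-- Iterated partial derivative `∂^α` for a multi-index `α ∈ ℕ^n`. -/
noncomputable def pdMulti {n : ℕ} (α : Fin n → ℕ) (f : EuclideanSpace ℝ (Fin n) → ℂ) :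
    EuclideanSpace ℝ (Fin n) → ℂ :=
  (List.finRange n).foldr (fun j g => (pd j)^[α j] g) f

/-- The short-time Fourier transform on `ℝ^{2d}` with window `Φ` and normalization `(2π)^{-d}`:
`V_Φ a (z, ζ) = (2π)^{−d} ∫ a(w) e^{−i⟨ζ,w⟩} conj(Φ(w−z)) dw`. -/
noncomputable def stft {n : ℕ} (d : ℕ) (Φ a : EuclideanSpace ℝ (Fin n) → ℂ)
    (z ζ : EuclideanSpace ℝ (Fin n)) : ℂ :=
  (((2 * Real.pi) ^ d : ℝ)⁻¹ : ℂ) *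
    ∫ w, a w * Complex.exp (-Complex.I * ((∑ j, ζ j * w j : ℝ) : ℂ)) *
      (starRingEnd ℂ) (Φ (w - z))

lemma pd_smooth {n : ℕ} (j : Fin n) {f : EuclideanSpace ℝ (Fin n) → ℂ}
    (hf : ContDiff ℝ (⊤ : ℕ∞) f) : ContDiff ℝ (⊤ : ℕ∞) (pd j f) := by
  unfold pd
  have h : ContDiff ℝ (⊤ : ℕ∞) (fderiv ℝ f) := hf.fderiv_right (by simp)
  exact h.clm_apply contDiff_const

lemma pd_iter_smooth {n : ℕ} (j : Fin n) {f : EuclideanSpace ℝ (Fin n) → ℂ}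
    (hf : ContDiff ℝ (⊤ : ℕ∞) f) (k : ℕ) : ContDiff ℝ (⊤ : ℕ∞) ((pd j)^[k] f) := by
  induction k with
  | zero => simpa using hf
  | succ k ih => rw [Function.iterate_succ_apply']; exact pd_smooth j ih

lemma pd_comm {n : ℕ} (i j : Fin n) {f : EuclideanSpace ℝ (Fin n) → ℂ}
    (hf : ContDiff ℝ (⊤ : ℕ∞) f) : pd i (pd j f) = pd j (pd i f) := by
  funext z
  have h : ContDiff ℝ (⊤ : ℕ∞) (fderiv ℝ f) := hf.fderiv_right (by simp)
  have hd : DifferentiableAt ℝ (fderiv ℝ f) z := h.differentiable (by simp) z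
  have key : ∀ u v : EuclideanSpace ℝ (Fin n),
      fderiv ℝ (fun y => fderiv ℝ f y u) z v = fderiv ℝ (fderiv ℝ f) z v u := by
    intro u v
    rw [fderiv_clm_apply hd (differentiableAt_const u)]
    simp
  have hsym : IsSymmSndFDerivAt ℝ f z :=
    hf.contDiffAt.isSymmSndFDerivAt (by
      simp only [minSmoothness_of_isRCLikeNormedField]
      exact WithTop.coe_le_coe.2 le_top)
  unfold pd
  rw [key, key]
  exact hsym _ _

lemma pd_iter_comm {n : ℕ} (i j : Fin n) {f : EuclideanSpace ℝ (Fin n) → ℂ}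
    (hf : ContDiff ℝ (⊤ : ℕ∞) f) (k : ℕ) : pd i ((pd j)^[k] f) = (pd j)^[k] (pd i f) := by
  induction k with
  | zero => simp
  | succ k ih =>
    rw [Function.iterate_succ_apply', Function.iterate_succ_apply',
      pd_comm i j (pd_iter_smooth j hf k), ih]

lemma foldr_smooth {n : ℕ} (α : Fin n → ℕ) {f : EuclideanSpace ℝ (Fin n) → ℂ}
    (hf : ContDiff ℝ (⊤ : ℕ∞) f) (l : List (Fin n)) :
    ContDiff ℝ (⊤ : ℕ∞) (l.foldr (fun j g => (pd j)^[α j] g) f) := by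
  induction l with
  | nil => simpa using hf
  | cons i l ih => rw [List.foldr_cons]; exact pd_iter_smooth i ih _

lemma foldr_notMem {n : ℕ} (α : Fin n → ℕ) (f : EuclideanSpace ℝ (Fin n) → ℂ)
    (j : Fin n) (l : List (Fin n)) (hj : j ∉ l) :
    l.foldr (fun i g => (pd i)^[(α + Pi.single j 1 : Fin n → ℕ) i] g) f =
      l.foldr (fun i g => (pd i)^[α i] g) f := by
  induction l with
  | nil => rfl
  | cons i l ih =>
    simp only [List.mem_cons, not_or] at hj
    rw [List.foldr_cons, List.foldr_cons, ih hj.2]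
    have : (α + Pi.single j 1 : Fin n → ℕ) i = α i := by
      simp [Pi.single_eq_of_ne (Ne.symm hj.1)]
    rw [this]

lemma foldr_mem {n : ℕ} (α : Fin n → ℕ) {f : EuclideanSpace ℝ (Fin n) → ℂ}
    (hf : ContDiff ℝ (⊤ : ℕ∞) f)
    (j : Fin n) (l : List (Fin n)) (hl : l.Nodup) (hj : j ∈ l) :
    l.foldr (fun i g => (pd i)^[(α + Pi.single j 1 : Fin n → ℕ) i] g) f =
      pd j (l.foldr (fun i g => (pd i)^[α i] g) f) := by
  induction l with
  | nil => simp at hj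
  | cons i l ih =>
    rw [List.nodup_cons] at hl
    rw [List.foldr_cons, List.foldr_cons]
    by_cases hij : j = i
    · subst hij
      rw [foldr_notMem α f j l hl.1]
      have : (α + Pi.single j 1 : Fin n → ℕ) j = α j + 1 := by simp
      rw [this, Function.iterate_succ_apply']
    · have hm : j ∈ l := by
        rcases List.mem_cons.1 hj with h | h
        · exact absurd h hij
        · exact h
      have : (α + Pi.single j 1 : Fin n → ℕ) i = α i := by
        simp [Pi.single_eq_of_ne (Ne.symm hij)]
      rw [ih hl.2 hm, this, pd_iter_comm j i (foldr_smooth α hf l)]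

lemma pdMulti_smooth {n : ℕ} (α : Fin n → ℕ) {f : EuclideanSpace ℝ (Fin n) → ℂ}
    (hf : ContDiff ℝ (⊤ : ℕ∞) f) : ContDiff ℝ (⊤ : ℕ∞) (pdMulti α f) :=
  foldr_smooth α hf _

lemma pdMulti_succ {n : ℕ} (α : Fin n → ℕ) {f : EuclideanSpace ℝ (Fin n) → ℂ}
    (hf : ContDiff ℝ (⊤ : ℕ∞) f) (j : Fin n) :
    pdMulti (α + Pi.single j 1) f = pd j (pdMulti α f) :=
  foldr_mem α hf j _ (List.nodup_finRange n) (List.mem_finRange j)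

lemma pdMulti_zero {n : ℕ} (f : EuclideanSpace ℝ (Fin n) → ℂ) :
    pdMulti (0 : Fin n → ℕ) f = f := by
  unfold pdMulti
  induction (List.finRange n) with
  | nil => rfl
  | cons i l ih => rw [List.foldr_cons, ih]; rfl

/-- The oscillating factor. -/
lemma osc_hasFDerivAt {n : ℕ} (ζ w : EuclideanSpace ℝ (Fin n)) (j : Fin n) :
    Differentiable ℝ (fun w : EuclideanSpace ℝ (Fin n) =>
      Complex.exp (-Complex.I * ((∑ j, ζ j * w j : ℝ) : ℂ))) ∧
    fderiv ℝ (fun w : EuclideanSpace ℝ (Fin n) =>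
      Complex.exp (-Complex.I * ((∑ j, ζ j * w j : ℝ) : ℂ))) w (EuclideanSpace.single j 1) =
      -Complex.I * (ζ j : ℂ) * Complex.exp (-Complex.I * ((∑ j, ζ j * w j : ℝ) : ℂ)) := by
  let L : EuclideanSpace ℝ (Fin n) →L[ℝ] ℂ :=
    (-Complex.I) • (Complex.ofRealCLM.comp (innerSL ℝ ζ))
  have hL : ∀ w : EuclideanSpace ℝ (Fin n), -Complex.I * ((∑ j, ζ j * w j : ℝ) : ℂ) = L w := by
    intro w
    simp [L, PiLp.inner_apply, mul_comm]
  simp only [hL]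
  have hd : ∀ w, HasFDerivAt (fun w => Complex.exp (L w)) (Complex.exp (L w) • L) w :=
    fun w => (L.hasFDerivAt).cexp
  refine ⟨fun w => (hd w).differentiableAt, ?_⟩
  rw [(hd w).fderiv]
  have : L (EuclideanSpace.single j 1) = -Complex.I * (ζ j : ℂ) := by
    rw [← hL]; simp [Pi.single_apply]
  rw [smul_apply, this, smul_eq_mul, mul_comm]

lemma osc_norm {n : ℕ} (ζ w : EuclideanSpace ℝ (Fin n)) :
    ‖Complex.exp (-Complex.I * ((∑ j, ζ j * w j : ℝ) : ℂ))‖ = 1 := by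
  rw [Complex.norm_exp]
  simp

/-- Iterated integration by parts, for an abstract doubly indexed family. -/
lemma ibp_family {n : ℕ} (F : (Fin n → ℕ) → (Fin n → ℕ) → EuclideanSpace ℝ (Fin n) → ℂ)
    (hF : ∀ β γ, Differentiable ℝ (F β γ))
    (hF' : ∀ β γ j w, fderiv ℝ (F β γ) w (EuclideanSpace.single j 1) =
      F (β + Pi.single j 1) γ w + F β (γ + Pi.single j 1) w)
    (K : EuclideanSpace ℝ (Fin n) → ℝ) (hK : Integrable K) (h s : ℝ) (hh : 0 < h) (hs : 0 < s)
    (hK0 : ∀ w, 0 ≤ K w)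
    (hb : ∀ β γ w, ‖F β γ w‖ ≤ h ^ (∑ j, (β + γ) j) *
      ((∏ j, ((β j)! : ℝ)) ^ s * (∏ j, ((γ j)! : ℝ)) ^ s) * K w)
    (ζ : EuclideanSpace ℝ (Fin n)) (N : ℕ) : ∀ (α β γ : Fin n → ℕ), ∑ j, α j = N →
    (∏ j, |ζ j| ^ α j) * ‖∫ w, F β γ w * Complex.exp (-Complex.I * ((∑ j, ζ j * w j : ℝ) : ℂ))‖ ≤
      2 ^ N * h ^ (∑ j, (α + β + γ) j) * (∏ j, (((α + β + γ) j)! : ℝ)) ^ s * ∫ w, K w := by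
  have hint : ∀ β γ, Integrable (fun w => F β γ w *
      Complex.exp (-Complex.I * ((∑ j, ζ j * w j : ℝ) : ℂ))) := by
    intro β γ
    refine Integrable.mono' (hK.const_mul (h ^ (∑ j, (β + γ) j) *
      ((∏ j, ((β j)! : ℝ)) ^ s * (∏ j, ((γ j)! : ℝ)) ^ s))) ?_ ?_
    · apply Continuous.aestronglyMeasurable
      exact (hF β γ).continuous.mul (by fun_prop)
    · refine Filter.Eventually.of_forall fun w => ?_
      rw [norm_mul, osc_norm, mul_one]
      exact hb β γ w
  induction N with
  | zero =>
    intro α β γ hα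
    have hα0 : α = 0 := by
      funext j
      exact (Finset.sum_eq_zero_iff.1 hα) j (Finset.mem_univ j)
    subst hα0
    simp only [Pi.zero_apply, pow_zero, Finset.prod_const_one, one_mul, zero_add]
    calc _ ≤ ∫ w, h ^ (∑ j, (β + γ) j) *
      ((∏ j, ((β j)! : ℝ)) ^ s * (∏ j, ((γ j)! : ℝ)) ^ s) * K w := by
          refine norm_integral_le_of_norm_le (hK.const_mul _)
            (Filter.Eventually.of_forall fun w => ?_)
          rw [norm_mul, osc_norm, mul_one]
          exact hb β γ w
      _ = h ^ (∑ j, (β + γ) j) *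
      ((∏ j, ((β j)! : ℝ)) ^ s * (∏ j, ((γ j)! : ℝ)) ^ s) * ∫ w, K w := integral_const_mul _ _
      _ ≤ _ := by
          have : (∏ j, ((β j)! : ℝ)) ^ s * (∏ j, ((γ j)! : ℝ)) ^ s ≤
              (∏ j, (((β + γ) j)! : ℝ)) ^ s := by
            rw [← Real.mul_rpow (by positivity) (by positivity), ← Finset.prod_mul_distrib]
            refine Real.rpow_le_rpow (by positivity) ?_ hs.le
            refine Finset.prod_le_prod (fun _ _ => by positivity) fun j _ => ?_
            exact_mod_cast Nat.le_of_dvd (Nat.factorial_pos _)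
              (Nat.factorial_mul_factorial_dvd_factorial_add _ _)
          have hKi : 0 ≤ ∫ w, K w := integral_nonneg hK0
          gcongr
  | succ N ih =>
    intro α β γ hα
    obtain ⟨j, hj⟩ : ∃ j, α j ≠ 0 := by
      by_contra hc
      push Not at hc
      simp [hc] at hα
    obtain ⟨α', rfl⟩ : ∃ α' : Fin n → ℕ, α = α' + Pi.single j 1 := by
      refine ⟨α - Pi.single j 1, ?_⟩
      funext i
      by_cases hi : i = j
      · subst hi; simp; omega
      · simp [Pi.single_eq_of_ne hi]
    have hα' : ∑ i, α' i = N := by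
      simp [Finset.sum_add_distrib] at hα
      omega
    have hprod : (∏ i, |ζ i| ^ (α' + Pi.single j 1 : Fin n → ℕ) i) = (∏ i, |ζ i| ^ α' i) * |ζ j| := by
      simp only [Pi.add_apply, pow_add, Finset.prod_mul_distrib]
      congr 1
      rw [Finset.prod_eq_single j]
      · simp
      · intro i _ hi; simp [Pi.single_eq_of_ne hi]
      · simp
    have hdE := fun w => osc_hasFDerivAt ζ w j
    have hibp := integral_mul_fderiv_eq_neg_fderiv_mul_of_integrable (𝕜 := ℂ) (μ := volume)
      (f := F β γ) (g := fun w => Complex.exp (-Complex.I * ((∑ j, ζ j * w j : ℝ) : ℂ)))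
      (v := EuclideanSpace.single j 1)
      (by
        simp only [hF', add_mul]
        exact (hint _ _).add (hint _ _))
      (by
        simp only [(hdE _).2]
        refine ((hint β γ).const_mul (-Complex.I * (ζ j : ℂ))).congr
          (Filter.Eventually.of_forall fun w => ?_)
        show _ * (_ * _) = _ * (_ * _)
        ring)
      (hint β γ) (fun x _ => hF β γ x) (fun x _ => (hdE x).1 x)
    simp only [hF', (hdE _).2, add_mul] at hibp
    rw [integral_add (hint _ _) (hint _ _)] at hibp
    have e1 : (∫ w, F β γ w * (-Complex.I * (ζ j : ℂ) *
        Complex.exp (-Complex.I * ((∑ j, ζ j * w j : ℝ) : ℂ)))) =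
        (-Complex.I * (ζ j : ℂ)) * ∫ w, F β γ w *
          Complex.exp (-Complex.I * ((∑ j, ζ j * w j : ℝ) : ℂ)) := by
      rw [← integral_const_mul]
      congr 1; funext w; ring
    rw [e1] at hibp
    have hn := congrArg norm hibp
    rw [norm_mul, norm_neg, norm_mul, norm_neg, Complex.norm_I, one_mul, Complex.norm_real,
      Real.norm_eq_abs] at hn
    have i1 := ih α' (β + Pi.single j 1) γ hα'
    have i2 := ih α' β (γ + Pi.single j 1) hα'
    rw [show α' + (β + Pi.single j 1) + γ = α' + Pi.single j 1 + β + γ by abel] at i1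
    rw [show α' + β + (γ + Pi.single j 1) = α' + Pi.single j 1 + β + γ by abel] at i2
    rw [hprod, mul_assoc, hn, pow_succ]
    refine (mul_le_mul_of_nonneg_left (norm_add_le _ _) (by positivity)).trans ?_
    rw [mul_add]
    linarith

lemma exists_pow_div_factorial (y : ℝ) (hy : 0 ≤ y) :
    ∃ k : ℕ, Real.exp (y / 2) / 2 ≤ y ^ k / (k ! : ℝ) := by
  by_contra hc
  push Not at hc
  have h1 : HasSum (fun k : ℕ => (y / 2) ^ k / (k ! : ℝ)) (Real.exp (y / 2)) := by
    rw [Real.exp_eq_exp_ℝ]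
    exact NormedSpace.expSeries_div_hasSum_exp (y / 2)
  have h2 : HasSum (fun k : ℕ => Real.exp (y / 2) / 2 * (1 / 2 : ℝ) ^ k)
      (Real.exp (y / 2) / 2 * 2) := hasSum_geometric_two.mul_left _
  have hlt : ∀ k : ℕ, (y / 2) ^ k / (k ! : ℝ) < Real.exp (y / 2) / 2 * (1 / 2 : ℝ) ^ k := by
    intro k
    have e : (y / 2) ^ k / (k ! : ℝ) = y ^ k / (k ! : ℝ) * (1 / 2 : ℝ) ^ k := by
      rw [div_pow, div_pow, one_pow]; ring
    rw [e]
    exact mul_lt_mul_of_pos_right (hc k) (by positivity)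
  have := hasSum_lt (fun k => (hlt k).le) (hlt 0) h1 h2
  linarith

lemma exists_pow_scalar (s H x : ℝ) (hs : 0 < s) (hH : 0 < H) (hx : 0 ≤ x) :
    ∃ k : ℕ, Real.exp (s / 2 * H ^ (-(1 / s)) * x ^ (1 / s)) * (H ^ k * (k ! : ℝ) ^ s) ≤
      (2 : ℝ) ^ s * x ^ k := by
  obtain ⟨k, hk⟩ := exists_pow_div_factorial ((x / H) ^ (1 / s)) (by positivity)
  refine ⟨k, ?_⟩
  set y := (x / H) ^ (1 / s) with hy
  have hy0 : 0 ≤ y := by positivity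
  have hys : y ^ s = x / H := by
    rw [hy, ← Real.rpow_mul (by positivity), one_div, inv_mul_cancel₀ hs.ne', Real.rpow_one]
  have hyx : y = H ^ (-(1 / s)) * x ^ (1 / s) := by
    rw [hy, Real.div_rpow hx hH.le, Real.rpow_neg hH.le]; ring
  have hk' : Real.exp (y / 2) * (k ! : ℝ) ≤ 2 * y ^ k := by
    have hf : (0 : ℝ) < (k ! : ℝ) := by positivity
    rw [le_div_iff₀ hf] at hk
    linarith
  have h3 := Real.rpow_le_rpow (by positivity) hk' hs.le
  rw [Real.mul_rpow (by positivity) (by positivity), Real.mul_rpow (by positivity) (by positivity),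
    ← Real.exp_mul, ← Real.rpow_natCast y k, ← Real.rpow_mul hy0, mul_comm (k : ℝ) s,
    Real.rpow_mul hy0, hys, Real.rpow_natCast, div_pow] at h3
  have e : s / 2 * H ^ (-(1 / s)) * x ^ (1 / s) = y / 2 * s := by rw [hyx]; ring
  rw [e]
  have hHk : 0 < H ^ k := by positivity
  calc _ = H ^ k * (Real.exp (y / 2 * s) * (k ! : ℝ) ^ s) := by ring
    _ ≤ H ^ k * (2 ^ s * (x ^ k / H ^ k)) := by gcongr
    _ = _ := by field_simp

lemma rpow_sum_le {ι : Type*} (S : Finset ι) (f : ι → ℝ) (hf : ∀ i, 0 ≤ f i) (q : ℝ) (hq : 0 < q)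
    (hq1 : q ≤ 1) : (∑ i ∈ S, f i) ^ q ≤ ∑ i ∈ S, f i ^ q := by
  classical
  induction S using Finset.induction_on with
  | empty => simp [Real.zero_rpow hq.ne']
  | insert i S hi ih =>
    rw [Finset.sum_insert hi, Finset.sum_insert hi]
    refine (Real.rpow_add_le_add_rpow (hf i) (Finset.sum_nonneg fun i _ => hf i) hq.le hq1).trans ?_
    linarith

lemma norm_rpow_le_sum {n : ℕ} (ζ : EuclideanSpace ℝ (Fin n)) (p : ℝ) (hp : 0 < p) (hp2 : p ≤ 2) :
    ‖ζ‖ ^ p ≤ ∑ j, |ζ j| ^ p := by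
  have h1 : ‖ζ‖ ^ p = (∑ j, |ζ j| ^ 2) ^ (p / 2) := by
    have : ∑ j, |ζ j| ^ 2 = ‖ζ‖ ^ 2 := by
      rw [EuclideanSpace.norm_sq_eq]; simp
    rw [this, ← Real.rpow_natCast, ← Real.rpow_mul (norm_nonneg _)]
    congr 1; push_cast; ring
  rw [h1]
  refine (rpow_sum_le _ _ (fun j => by positivity) (p / 2) (by linarith) (by linarith)).trans ?_
  refine Finset.sum_le_sum fun j _ => le_of_eq ?_
  rw [← Real.rpow_natCast, ← Real.rpow_mul (abs_nonneg _)]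
  congr 1; push_cast; ring

lemma decay_of_moments {n : ℕ} (ζ : EuclideanSpace ℝ (Fin n)) (s H X M b : ℝ) (hs : 1 / 2 < s)
    (hH : 0 < H) (hX : 0 ≤ X) (hb : b = s / 2 * H ^ (-(1 / s)))
    (h : ∀ α : Fin n → ℕ, (∏ j, |ζ j| ^ α j) * X ≤
      H ^ (∑ j, α j) * (∏ j, ((α j)! : ℝ)) ^ s * M) :
    X ≤ ((2 : ℝ) ^ s) ^ n * M * Real.exp (-(b * ‖ζ‖ ^ (1 / s))) := by
  have hs0 : 0 < s := by linarith
  choose k hk using fun j => exists_pow_scalar s H |ζ j| hs0 hH (abs_nonneg _)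
  have hb0 : 0 < b := by rw [hb]; positivity
  have hprod := Finset.prod_le_prod (s := Finset.univ) (fun j _ => by positivity) (fun j _ => hk j)
  rw [Finset.prod_mul_distrib, Finset.prod_mul_distrib, Finset.prod_mul_distrib,
    Finset.prod_const, Finset.card_univ, Fintype.card_fin, ← Real.exp_sum,
    ← Finset.mul_sum, ← hb, Finset.prod_pow_eq_pow_sum,
    Real.finsetProd_rpow _ _ (fun j _ => by positivity)] at hprod
  set P := H ^ (∑ j, k j) * (∏ j, ((k j)! : ℝ)) ^ s with hP
  have hP0 : 0 < P := by positivity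
  have h1 := h k
  have hexp : Real.exp (b * ‖ζ‖ ^ (1 / s)) ≤ Real.exp (b * ∑ j, |ζ j| ^ (1 / s)) := by
    refine Real.exp_le_exp.2 (mul_le_mul_of_nonneg_left ?_ hb0.le)
    refine norm_rpow_le_sum ζ _ (by positivity) ?_
    rw [div_le_iff₀ hs0]; linarith
  rw [Real.exp_neg, ← div_eq_mul_inv, le_div_iff₀ (Real.exp_pos _)]
  refine le_of_mul_le_mul_left ?_ hP0
  calc P * (X * Real.exp (b * ‖ζ‖ ^ (1 / s)))
      ≤ P * (X * Real.exp (b * ∑ j, |ζ j| ^ (1 / s))) := by gcongr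
    _ = (Real.exp (b * ∑ j, |ζ j| ^ (1 / s)) * P) * X := by ring
    _ ≤ (((2 : ℝ) ^ s) ^ n * ∏ j, |ζ j| ^ k j) * X := by gcongr
    _ = ((2 : ℝ) ^ s) ^ n * ((∏ j, |ζ j| ^ k j) * X) := by ring
    _ ≤ ((2 : ℝ) ^ s) ^ n * (P * M) := by gcongr
    _ = _ := by ring

lemma integrable_exp_neg_norm_rpow {n : ℕ} (hn : 0 < n) (p : ℝ) (hp : 0 < p) :
    Integrable (fun x : EuclideanSpace ℝ (Fin n) => Real.exp (-‖x‖ ^ p)) := by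
  haveI : Nonempty (Fin n) := ⟨⟨0, hn⟩⟩
  refine (integrable_fun_norm_addHaar (volume : Measure (EuclideanSpace ℝ (Fin n)))
    (f := fun r : ℝ => Real.exp (-r ^ p))).2 ?_
  refine (integrableOn_rpow_mul_exp_neg_rpow (p := p)
    (s := ((Module.finrank ℝ (EuclideanSpace ℝ (Fin n)) - 1 : ℕ) : ℝ)) ?_ hp).congr_fun ?_
    measurableSet_Ioi
  · have : (0 : ℝ) ≤ ((Module.finrank ℝ (EuclideanSpace ℝ (Fin n)) - 1 : ℕ) : ℝ) := by positivity
    linarith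
  · intro x _
    simp only [Real.rpow_natCast, smul_eq_mul]

lemma add_rpow_crude (x y p : ℝ) (hx : 0 ≤ x) (hy : 0 ≤ y) (hp : 0 < p) :
    (x + y) ^ p ≤ 2 ^ p * (x ^ p + y ^ p) := by
  have hxp : 0 ≤ x ^ p := by positivity
  have hyp : 0 ≤ y ^ p := by positivity
  rcases le_total x y with h | h
  · calc (x + y) ^ p ≤ (2 * y) ^ p := Real.rpow_le_rpow (by positivity) (by linarith) hp.le
      _ = 2 ^ p * y ^ p := Real.mul_rpow (by norm_num) hy
      _ ≤ _ := by gcongr; linarith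
  · calc (x + y) ^ p ≤ (2 * x) ^ p := Real.rpow_le_rpow (by positivity) (by linarith) hp.le
      _ = 2 ^ p * x ^ p := Real.mul_rpow (by norm_num) hx
      _ ≤ _ := by gcongr; linarith

lemma fderiv_pair {n : ℕ} (a Φ : EuclideanSpace ℝ (Fin n) → ℂ) (ha : ContDiff ℝ (⊤ : ℕ∞) a)
    (hΦ : ContDiff ℝ (⊤ : ℕ∞) Φ) (z : EuclideanSpace ℝ (Fin n)) (β γ : Fin n → ℕ) :
    Differentiable ℝ (fun w => pdMulti β a w * (starRingEnd ℂ) (pdMulti γ Φ (w - z))) ∧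
    ∀ j w, fderiv ℝ (fun w => pdMulti β a w * (starRingEnd ℂ) (pdMulti γ Φ (w - z))) w
      (EuclideanSpace.single j 1) =
      pdMulti (β + Pi.single j 1) a w * (starRingEnd ℂ) (pdMulti γ Φ (w - z)) +
      pdMulti β a w * (starRingEnd ℂ) (pdMulti (γ + Pi.single j 1) Φ (w - z)) := by
  have key : ∀ w, HasFDerivAt
      (fun w => pdMulti β a w * (starRingEnd ℂ) (pdMulti γ Φ (w - z)))
      (pdMulti β a w • (Complex.conjCLE.toContinuousLinearMap.comp (fderiv ℝ (pdMulti γ Φ) (w - z)))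
        + (starRingEnd ℂ) (pdMulti γ Φ (w - z)) • fderiv ℝ (pdMulti β a) w) w := by
    intro w
    have h1 : HasFDerivAt (pdMulti β a) (fderiv ℝ (pdMulti β a) w) w :=
      ((pdMulti_smooth β ha).differentiable (by simp) w).hasFDerivAt
    have h2 : HasFDerivAt (pdMulti γ Φ) (fderiv ℝ (pdMulti γ Φ) (w - z)) (w - z) :=
      ((pdMulti_smooth γ hΦ).differentiable (by simp) (w - z)).hasFDerivAt
    have h3 : HasFDerivAt (fun w => pdMulti γ Φ (w - z)) (fderiv ℝ (pdMulti γ Φ) (w - z)) w :=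
      h2.comp w ((hasFDerivAt_id w).sub_const z)
    have h4 : HasFDerivAt (fun w => (starRingEnd ℂ) (pdMulti γ Φ (w - z)))
        (Complex.conjCLE.toContinuousLinearMap.comp (fderiv ℝ (pdMulti γ Φ) (w - z))) w :=
      (Complex.conjCLE.toContinuousLinearMap.hasFDerivAt).comp w h3
    exact h1.mul h4
  refine ⟨fun w => (key w).differentiableAt, fun j w => ?_⟩
  rw [(key w).fderiv, pdMulti_succ β ha, pdMulti_succ γ hΦ]
  simp [pd]
  ring

/-- Let `ε > 0`, `d ≥ 1`, `s > 1/2`, `μ = s 2^{−4−3/(2s)} d^{−1/(2s)}`.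
Suppose `a_t` (`t ∈ [0, ε]`) is a family of smooth functions on `ℝ^{2d}` satisfying, for every
`h > 0`, `|∂^α a_t(z)| ≲ h^{|α|} (α!)^s exp(μ h^{−1/s} |z|^{1/s})` uniformly in `t`, and `Φ` is
a smooth nonzero Gelfand–Shilov window, i.e. for every `A > 0`,
`|∂^β Φ(x)| ≲ (β!)^s A^{−|β|} exp(−A|x|^{1/s})`.  Then for any `b > 0`,
`|V_Φ a_t (z, ζ)| ≲ exp((b/4)|z|^{1/s} − b|ζ|^{1/s})` uniformly in `t ∈ [0, ε]`. -/
theorem stft_gaussian_decay_estimate (d : ℕ) (hd : 1 ≤ d) (ε s μ : ℝ) (hε : 0 < ε)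
    (hs : 1 / 2 < s)
    (hμ : μ = s * (2 : ℝ) ^ (-4 - 3 / (2 * s)) * (d : ℝ) ^ (-(1 / (2 * s))))
    (a : ℝ → EuclideanSpace ℝ (Fin (2 * d)) → ℂ)
    (ha_smooth : ∀ t ∈ Set.Icc (0 : ℝ) ε, ContDiff ℝ (⊤ : ℕ∞) (a t))
    (ha : ∀ h : ℝ, 0 < h → ∃ C : ℝ, 0 < C ∧
      ∀ t ∈ Set.Icc (0 : ℝ) ε, ∀ (z : EuclideanSpace ℝ (Fin (2 * d))) (α : Fin (2 * d) → ℕ),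
        ‖pdMulti α (a t) z‖ ≤
          C * h ^ (∑ j, α j) * (∏ j, ((α j)! : ℝ)) ^ s *
            Real.exp (μ * h ^ (-(1 / s)) * ‖z‖ ^ (1 / s)))
    (Φ : EuclideanSpace ℝ (Fin (2 * d)) → ℂ) (hΦ_smooth : ContDiff ℝ (⊤ : ℕ∞) Φ) (hΦ_ne : Φ ≠ 0)
    (hΦ : ∀ A : ℝ, 0 < A → ∃ C : ℝ, 0 < C ∧
      ∀ (β : Fin (2 * d) → ℕ) (x : EuclideanSpace ℝ (Fin (2 * d))),
        ‖pdMulti β Φ x‖ ≤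
          C * (∏ j, ((β j)! : ℝ)) ^ s / A ^ (∑ j, β j) * Real.exp (-(A * ‖x‖ ^ (1 / s)))) :
    ∀ b : ℝ, 0 < b → ∃ C : ℝ, 0 < C ∧
      ∀ t ∈ Set.Icc (0 : ℝ) ε, ∀ z ζ : EuclideanSpace ℝ (Fin (2 * d)),
        ‖stft d Φ (a t) z ζ‖ ≤
          C * Real.exp (b / 4 * ‖z‖ ^ (1 / s) - b * ‖ζ‖ ^ (1 / s)) := by
  intro b hb
  have hs0 : 0 < s := by linarith
  have hd0 : (1 : ℝ) ≤ d := by exact_mod_cast hd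
  have hμ0 : 0 < μ := by rw [hμ]; positivity
  have hp : 0 < 1 / s := by positivity
  have hp2 : 1 / s < 2 := by rw [div_lt_iff₀ hs0]; linarith
  obtain ⟨h, hh, hhp⟩ : ∃ h : ℝ, 0 < h ∧ h ^ (-(1 / s)) = 2 * b / s * 2 ^ (1 / s) := by
    refine ⟨(2 * b / s * 2 ^ (1 / s)) ^ (-s), by positivity, ?_⟩
    rw [← Real.rpow_mul (by positivity), show -s * -(1 / s) = 1 by field_simp, Real.rpow_one]
  have hH : b = s / 2 * (2 * h) ^ (-(1 / s)) := by
    rw [Real.mul_rpow (by norm_num) hh.le, hhp, Real.rpow_neg (by norm_num)]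
    have : (0 : ℝ) < 2 ^ (1 / s) := by positivity
    field_simp
  obtain ⟨C₁, hC₁, ha'⟩ := ha h hh
  set E := μ * h ^ (-(1 / s)) * 2 ^ (1 / s) with hE
  have hE0 : 0 < E := by positivity
  have hEb : E ≤ b / 4 := by
    have h1 : (d : ℝ) ^ (-(1 / (2 * s))) ≤ 1 :=
      Real.rpow_le_one_of_one_le_of_nonpos hd0 (by
        have : 0 < 1 / (2 * s) := by positivity
        linarith)
    have h2 : (2 : ℝ) ^ (-4 - 3 / (2 * s)) * (2 ^ (1 / s) * 2 ^ (1 / s)) ≤ 1 / 8 := by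
      rw [← Real.rpow_add (by norm_num), ← Real.rpow_add (by norm_num)]
      have e : -4 - 3 / (2 * s) + (1 / s + 1 / s) = -4 + (1 / s) / 2 := by field_simp; ring
      rw [e]
      calc (2 : ℝ) ^ (-4 + (1 / s) / 2) ≤ 2 ^ (-3 : ℝ) :=
            Real.rpow_le_rpow_of_exponent_le (by norm_num) (by linarith)
        _ = 1 / 8 := by
          rw [show (-3 : ℝ) = ((-3 : ℤ) : ℝ) by norm_num, Real.rpow_intCast]; norm_num
    have e : E = 2 * b * ((2 : ℝ) ^ (-4 - 3 / (2 * s)) * (2 ^ (1 / s) * 2 ^ (1 / s))) *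
        (d : ℝ) ^ (-(1 / (2 * s))) := by
      rw [hE, hhp, hμ]; field_simp
    rw [e]
    calc _ ≤ 2 * b * (1 / 8) * 1 := by gcongr
      _ = b / 4 := by ring
  set A := 1 / h + E + 1 with hA
  have hA0 : 0 < A := by positivity
  obtain ⟨C₂, hC₂, hΦ'⟩ := hΦ A hA0
  have hI := integrable_exp_neg_norm_rpow (n := 2 * d) (by omega) (1 / s) hp
  set J := ∫ x : EuclideanSpace ℝ (Fin (2 * d)), Real.exp (-‖x‖ ^ (1 / s)) with hJ
  have hJ0 : 0 ≤ J := integral_nonneg fun x => (Real.exp_pos _).le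
  refine ⟨((2 * Real.pi) ^ d)⁻¹ * (((2 : ℝ) ^ s) ^ (2 * d) * (C₁ * C₂ * (J + 1))),
    by positivity, ?_⟩
  intro t ht z ζ
  have hX := decay_of_moments ζ s (2 * h)
    ‖∫ w, (a t w * (starRingEnd ℂ) (Φ (w - z))) *
      Complex.exp (-Complex.I * ((∑ j, ζ j * w j : ℝ) : ℂ))‖
    (C₁ * C₂ * Real.exp (E * ‖z‖ ^ (1 / s)) * J) b hs (by positivity) (norm_nonneg _) hH (by
      intro α
      have hK : Integrable (fun w : EuclideanSpace ℝ (Fin (2 * d)) =>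
          C₁ * C₂ * Real.exp (E * ‖z‖ ^ (1 / s)) * Real.exp (-‖w - z‖ ^ (1 / s))) :=
        (hI.comp_sub_right z).const_mul _
      have key := ibp_family
        (fun β γ w => pdMulti β (a t) w * (starRingEnd ℂ) (pdMulti γ Φ (w - z)))
        (fun β γ => (fderiv_pair (a t) Φ (ha_smooth t ht) hΦ_smooth z β γ).1)
        (fun β γ => (fderiv_pair (a t) Φ (ha_smooth t ht) hΦ_smooth z β γ).2)
        _ hK h s hh hs0 (fun w => by positivity) (by
          intro β γ w
          rw [norm_mul, RCLike.norm_conj]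
          refine (mul_le_mul (ha' t ht w β) (hΦ' γ (w - z)) (norm_nonneg _)
            (by positivity)).trans ?_
          have hAh : 1 / A ^ (∑ j, γ j) ≤ h ^ (∑ j, γ j) := by
            rw [← one_div_pow]
            refine pow_le_pow_left₀ (by positivity) ?_ _
            rw [div_le_iff₀ hA0]
            have : h * A = 1 + h * E + h := by rw [hA]; field_simp
            rw [this]; nlinarith [mul_pos hh hE0]
          have hexp : Real.exp (μ * h ^ (-(1 / s)) * ‖w‖ ^ (1 / s)) *
              Real.exp (-(A * ‖w - z‖ ^ (1 / s))) ≤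
              Real.exp (E * ‖z‖ ^ (1 / s)) * Real.exp (-‖w - z‖ ^ (1 / s)) := by
            rw [← Real.exp_add, ← Real.exp_add]
            refine Real.exp_le_exp.2 ?_
            have h1 : ‖w‖ ^ (1 / s) ≤ 2 ^ (1 / s) * (‖z‖ ^ (1 / s) + ‖w - z‖ ^ (1 / s)) := by
              refine le_trans (Real.rpow_le_rpow (norm_nonneg _) ?_ hp.le)
                (add_rpow_crude ‖z‖ ‖w - z‖ (1 / s) (norm_nonneg _) (norm_nonneg _) hp)
              calc ‖w‖ = ‖z + (w - z)‖ := by congr 1; abel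
                _ ≤ _ := norm_add_le _ _
            have h2 : μ * h ^ (-(1 / s)) * ‖w‖ ^ (1 / s) ≤
                E * (‖z‖ ^ (1 / s) + ‖w - z‖ ^ (1 / s)) := by
              rw [hE, mul_assoc (μ * h ^ (-(1 / s)))]
              exact mul_le_mul_of_nonneg_left h1 (by positivity)
            have h3 : 0 ≤ 1 / h * ‖w - z‖ ^ (1 / s) := by positivity
            rw [hA]
            linarith
          have hsum : ∑ j, (β + γ) j = ∑ j, β j + ∑ j, γ j := by
            simp [Finset.sum_add_distrib]
          rw [hsum, pow_add]
          calc _ = C₁ * C₂ * h ^ (∑ j, β j) * (1 / A ^ (∑ j, γ j)) *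
                ((∏ j, ((β j)! : ℝ)) ^ s * (∏ j, ((γ j)! : ℝ)) ^ s) *
                (Real.exp (μ * h ^ (-(1 / s)) * ‖w‖ ^ (1 / s)) *
                Real.exp (-(A * ‖w - z‖ ^ (1 / s)))) := by ring
            _ ≤ C₁ * C₂ * h ^ (∑ j, β j) * (h ^ (∑ j, γ j)) *
                ((∏ j, ((β j)! : ℝ)) ^ s * (∏ j, ((γ j)! : ℝ)) ^ s) *
                (Real.exp (E * ‖z‖ ^ (1 / s)) * Real.exp (-‖w - z‖ ^ (1 / s))) := by
                  gcongr
            _ = _ := by ring)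
        ζ (∑ j, α j) α 0 0 rfl
      have hJz : (∫ w : EuclideanSpace ℝ (Fin (2 * d)),
          C₁ * C₂ * Real.exp (E * ‖z‖ ^ (1 / s)) * Real.exp (-‖w - z‖ ^ (1 / s))) =
          C₁ * C₂ * Real.exp (E * ‖z‖ ^ (1 / s)) * J := by
        rw [integral_const_mul, integral_sub_right_eq_self
          (fun w : EuclideanSpace ℝ (Fin (2 * d)) => Real.exp (-‖w‖ ^ (1 / s))) z]
      rw [hJz] at key
      simp only [pdMulti_zero, add_zero] at key
      rw [mul_pow]
      exact key)
  have hst : stft d Φ (a t) z ζ = (((2 * Real.pi) ^ d : ℝ)⁻¹ : ℂ) *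
      ∫ w, (a t w * (starRingEnd ℂ) (Φ (w - z))) *
      Complex.exp (-Complex.I * ((∑ j, ζ j * w j : ℝ) : ℂ)) := by
    unfold stft
    congr 2
    funext w
    ring
  have hnorm : ‖(((2 * Real.pi) ^ d : ℝ)⁻¹ : ℂ)‖ = ((2 * Real.pi) ^ d)⁻¹ := by
    rw [norm_inv, Complex.norm_real, Real.norm_of_nonneg (by positivity)]
  rw [hst, norm_mul, hnorm, mul_assoc]
  refine mul_le_mul_of_nonneg_left (hX.trans ?_) (by positivity)
  have hz : Real.exp (E * ‖z‖ ^ (1 / s)) ≤ Real.exp (b / 4 * ‖z‖ ^ (1 / s)) := by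
    refine Real.exp_le_exp.2 ?_
    gcongr
  rw [sub_eq_add_neg, Real.exp_add]
  calc _ ≤ ((2 : ℝ) ^ s) ^ (2 * d) * (C₁ * C₂ * Real.exp (b / 4 * ‖z‖ ^ (1 / s)) * (J + 1)) *
        Real.exp (-(b * ‖ζ‖ ^ (1 / s))) := by
          gcongr; linarith
    _ = _ := by ring
end

section
/- Let ε > 0, d ≥ 1, s > 1/2 and μ > 0. Suppose a_t : ℝ^{2d} → ℂ, for 0 ≤ t ≤ ε, is a family of smooth functions such that for every h > 0 there is C_h > 0 with |∂^α a_t(z)| ≤ C_h h^{|α|} (α!)^s exp(μ h^{−1/s} |z|^{1/s}) for all z ∈ ℝ^{2d}, α ∈ ℕ^{2d}, t ∈ [0,ε]. Let Φ : ℝ^{2d} → ℂ be smooth and satisfy: for every A > 0 there is C_A > 0 with |∂^β Φ(x)| ≤ C_A (β!)^s A^{−|β|} exp(−A|x|^{1/s}) for all β ∈ ℕ^{2d}, x ∈ ℝ^{2d}. Then for all h₁ > 0 and h₂ > 0 with h₂^{−1} > 2 μ h₁^{−1/s}, there exists a constant C > 0 such that |ζ^α V_Φ a_t(z,ζ)|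 ≤ C (α!)^s (h₁+h₂)^{|α|} exp(2 μ h₁^{−1/s} |z|^{1/s}) for all z, ζ ∈ ℝ^{2d}, all multi-indices α ∈ ℕ^{2d}, and all t ∈ [0,ε]. -/
open scoped Nat
open MeasureTheory

namespace StftAux

abbrev Eu (n : ℕ) := EuclideanSpace ℝ (Fin n)

/-- iterated derivative along a word of directions -/
noncomputable def DW {n : ℕ} (w : List (Fin n)) (f : Eu n → ℂ) : Eu n → ℂ :=
  w.foldr (fun j g => pd j g) f

/-- canonical (sorted) word of a multi-index -/
def W {n : ℕ} (α : Fin n → ℕ) : List (Fin n) :=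
  (List.finRange n).flatMap (fun j => List.replicate (α j) j)

/-- all ways of distributing the letters of a word -/
def splits {β : Type} : List β → List (List β × List β)
  | [] => [([], [])]
  | j :: w => (splits w).map (fun p => (j :: p.1, p.2)) ++ (splits w).map (fun p => (p.1, j :: p.2))

theorem DW_nil {n : ℕ} (f : Eu n → ℂ) : DW [] f = f := rfl

theorem DW_cons {n : ℕ} (j : Fin n) (w : List (Fin n)) (f : Eu n → ℂ) :
    DW (j :: w) f = pd j (DW w f) := rfl

theorem DW_replicate_append {n : ℕ} (j : Fin n) (k : ℕ) (w : List (Fin n)) (f : Eu n → ℂ) :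
    DW (List.replicate k j ++ w) f = (pd j)^[k] (DW w f) := by
  induction k with
  | zero => simp
  | succ k ih =>
    rw [List.replicate_succ, List.cons_append, DW_cons, ih, Function.iterate_succ_apply']

theorem pdMulti_eq {n : ℕ} (α : Fin n → ℕ) (f : Eu n → ℂ) : pdMulti α f = DW (W α) f := by
  unfold pdMulti W
  induction List.finRange n with
  | nil => rfl
  | cons j L ih =>
    rw [List.foldr_cons, List.flatMap_cons, DW_replicate_append, ih]

theorem prod_W {n : ℕ} (α : Fin n → ℕ) (f : Fin n → ℂ) :
    ((W α).map f).prod = ∏ j, f j ^ α j := by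
  have : ∀ L : List (Fin n), ((L.flatMap (fun j => List.replicate (α j) j)).map f).prod
      = (L.map (fun j => f j ^ α j)).prod := by
    intro L
    induction L with
    | nil => rfl
    | cons j L ih =>
      rw [List.flatMap_cons, List.map_append, List.prod_append, ih]
      simp
  unfold W
  rw [this, ← List.ofFn_eq_map, List.prod_ofFn]

theorem count_W {n : ℕ} (α : Fin n → ℕ) (i : Fin n) : (W α).count i = α i := by
  unfold W
  rw [List.count_flatMap]
  have : (List.map (List.count i ∘ fun j => List.replicate (α j) j) (List.finRange n))
      = List.ofFn (fun j => if j = i then α j else 0) := by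
    rw [List.ofFn_eq_map]
    apply List.map_congr_left
    intro j _
    simp [List.count_replicate]
  rw [this, List.sum_ofFn]
  simp

theorem length_W {n : ℕ} (α : Fin n → ℕ) : (W α).length = ∑ j, α j := by
  unfold W
  rw [List.length_flatMap]
  simp only [List.length_replicate]
  rw [← List.ofFn_eq_map, List.sum_ofFn]

theorem sorted_W {n : ℕ} (α : Fin n → ℕ) : (W α).Pairwise (· ≤ ·) := by
  unfold W
  rw [List.pairwise_flatMap]
  refine ⟨fun j _ => ?_, ?_⟩
  · rw [List.pairwise_replicate]; right; exact le_refl j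
  · refine (List.pairwise_lt_finRange n).imp ?_
    intro a b hab x hx y hy
    rw [List.eq_of_mem_replicate hx, List.eq_of_mem_replicate hy]
    exact hab.le

theorem eq_W {n : ℕ} (u : List (Fin n)) (hu : u.Pairwise (· ≤ ·)) :
    u = W (fun j => u.count j) := by
  refine List.Perm.eq_of_pairwise' hu (sorted_W _) ?_
  rw [List.perm_iff_count]
  intro i
  rw [count_W]

theorem splits_prop {β : Type} [DecidableEq β] (w : List β) : ∀ p ∈ splits w,
    p.1.Sublist w ∧ p.2.Sublist w ∧ ∀ j, p.1.count j + p.2.count j = w.count j := by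
  induction w with
  | nil => intro p hp; simp [splits] at hp; subst hp; simp
  | cons j w ih =>
    intro p hp
    simp only [splits, List.mem_append, List.mem_map] at hp
    rcases hp with ⟨q, hq, rfl⟩ | ⟨q, hq, rfl⟩
    · obtain ⟨h1, h2, h3⟩ := ih q hq
      refine ⟨h1.cons_cons j, h2.cons j, fun i => ?_⟩
      simp only [List.count_cons]; rw [← h3 i]; ring
    · obtain ⟨h1, h2, h3⟩ := ih q hq
      refine ⟨h1.cons j, h2.cons_cons j, fun i => ?_⟩
      simp only [List.count_cons]; rw [← h3 i]; ring

theorem splits_sum {β : Type} (x y : ℝ) (w : List β) :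
    ((splits w).map (fun p => x ^ p.1.length * y ^ p.2.length)).sum = (x + y) ^ w.length := by
  induction w with
  | nil => simp [splits]
  | cons j w ih =>
    rw [splits, List.map_append, List.sum_append, List.map_map, List.map_map, List.length_cons,
      pow_succ', add_mul, ← ih, ← List.sum_map_mul_left, ← List.sum_map_mul_left]
    congr 2
    · apply List.map_congr_left
      intro p _
      simp only [Function.comp, List.length_cons]; ring
    · apply List.map_congr_left
      intro p _
      simp only [Function.comp, List.length_cons]; ring

theorem pd_smooth {n : ℕ} (j : Fin n) {f : Eu n → ℂ} (hf : ContDiff ℝ (⊤ : ℕ∞) f) :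
    ContDiff ℝ (⊤ : ℕ∞) (pd j f) := by
  unfold pd
  exact (hf.fderiv_right (m := (⊤ : ℕ∞)) (by simp)).clm_apply contDiff_const

theorem DW_smooth {n : ℕ} (w : List (Fin n)) {f : Eu n → ℂ} (hf : ContDiff ℝ (⊤ : ℕ∞) f) :
    ContDiff ℝ (⊤ : ℕ∞) (DW w f) := by
  induction w with
  | nil => exact hf
  | cons j w ih => exact pd_smooth j ih

theorem sm_diff {n : ℕ} {f : Eu n → ℂ} (hf : ContDiff ℝ (⊤ : ℕ∞) f) : Differentiable ℝ f :=
  hf.differentiable (by simp)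

theorem pd_mul {n : ℕ} (j : Fin n) {f g : Eu n → ℂ} (hf : Differentiable ℝ f)
    (hg : Differentiable ℝ g) (x : Eu n) :
    pd j (fun x => f x * g x) x = pd j f x * g x + f x * pd j g x := by
  unfold pd
  rw [fderiv_fun_mul (hf x) (hg x)]
  simp
  ring

theorem pd_list_sum {n : ℕ} (j : Fin n) {ι : Type} (L : List ι) (F : ι → Eu n → ℂ)
    (hF : ∀ i, Differentiable ℝ (F i)) :
    (Differentiable ℝ (fun x => (L.map (fun i => F i x)).sum)) ∧
    pd j (fun x => (L.map (fun i => F i x)).sum) =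
      fun x => (L.map (fun i => pd j (F i) x)).sum := by
  induction L with
  | nil =>
    refine ⟨by simp, ?_⟩
    funext x; simp [pd]
  | cons a L ih =>
    simp only [List.map_cons, List.sum_cons]
    refine ⟨(hF a).add ih.1, ?_⟩
    funext x
    have h2 := congrFun ih.2 x
    rw [← h2]
    unfold pd
    rw [fderiv_fun_add (hF a x) (ih.1 x)]
    rfl

theorem leibniz {n : ℕ} (w : List (Fin n)) {f g : Eu n → ℂ} (hf : ContDiff ℝ (⊤ : ℕ∞) f)
    (hg : ContDiff ℝ (⊤ : ℕ∞) g) :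
    DW w (fun x => f x * g x) =
      fun x => ((splits w).map (fun p => DW p.1 f x * DW p.2 g x)).sum := by
  induction w with
  | nil => funext x; simp [splits, DW]
  | cons j w ih =>
    rw [DW_cons, ih]
    rw [(pd_list_sum j (splits w) (fun p x => DW p.1 f x * DW p.2 g x) (fun p =>
      (sm_diff (DW_smooth p.1 hf)).mul (sm_diff (DW_smooth p.2 hg)))).2]
    funext x
    rw [splits, List.map_append, List.sum_append, List.map_map, List.map_map,
      ← List.sum_map_add]
    congr 1
    apply List.map_congr_left
    intro p _
    rw [pd_mul j (sm_diff (DW_smooth p.1 hf)) (sm_diff (DW_smooth p.2 hg))]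
    rfl

theorem DW_conj_trans {n : ℕ} (w : List (Fin n)) {f : Eu n → ℂ} (hf : ContDiff ℝ (⊤ : ℕ∞) f)
    (z : Eu n) :
    DW w (fun x => (starRingEnd ℂ) (f (x - z))) = fun x => (starRingEnd ℂ) (DW w f (x - z)) := by
  induction w with
  | nil => rfl
  | cons j w ih =>
    rw [DW_cons, ih, DW_cons]
    funext x
    unfold pd
    have h1 : HasFDerivAt (fun x => DW w f (x - z)) (fderiv ℝ (DW w f) (x - z)) x :=
      (((sm_diff (DW_smooth w hf)) (x - z)).hasFDerivAt).comp x ((hasFDerivAt_id x).sub_const z)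
    have h2 := (Complex.conjCLE.toContinuousLinearMap.hasFDerivAt
      (x := DW w f (x - z))).comp x h1
    have h3 : (fun x => (starRingEnd ℂ) (DW w f (x - z))) =
      (Complex.conjCLE.toContinuousLinearMap ∘ fun x => DW w f (x - z)) := by
      funext x; simp
    rw [h3, h2.fderiv]
    simp

theorem conj_trans_smooth {n : ℕ} {f : Eu n → ℂ} (hf : ContDiff ℝ (⊤ : ℕ∞) f) (z : Eu n) :
    ContDiff ℝ (⊤ : ℕ∞) (fun x => (starRingEnd ℂ) (f (x - z))) := by
  have h := Complex.conjCLE.toContinuousLinearMap.contDiff.comp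
    (hf.comp (contDiff_id.sub (contDiff_const (c := z))))
  convert h using 1
  funext x
  simp

/-- the Fourier character -/
noncomputable def ch {n : ℕ} (ζ : Eu n) (w : Eu n) : ℂ :=
  Complex.exp (-Complex.I * ((∑ j, ζ j * w j : ℝ) : ℂ))

theorem norm_ch {n : ℕ} (ζ w : Eu n) : ‖ch ζ w‖ = 1 := by
  unfold ch
  rw [Complex.norm_exp]
  simp

theorem ch_deriv {n : ℕ} (ζ x : Eu n) (j : Fin n) :
    DifferentiableAt ℝ (ch ζ) x ∧ fderiv ℝ (ch ζ) x (EuclideanSpace.single j 1) =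
      -(Complex.I * ζ j) * ch ζ x := by
  have h1 : HasFDerivAt (fun w : Eu n => ((∑ j, ζ j * w j : ℝ)))
      (∑ j, ζ j • (EuclideanSpace.proj j : Eu n →L[ℝ] ℝ)) x := by
    apply HasFDerivAt.fun_sum
    intro i _
    exact ((EuclideanSpace.proj i : Eu n →L[ℝ] ℝ).hasFDerivAt).const_mul (ζ i)
  have h2 := ((Complex.ofRealCLM.hasFDerivAt).comp x h1).const_mul (-Complex.I)
  have h3 := h2.cexp
  have h4 : HasFDerivAt (ch ζ) _ x := h3
  refine ⟨h4.differentiableAt, ?_⟩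
  rw [h4.fderiv]
  simp [ch]
  ring

theorem ch_cont {n : ℕ} (ζ : Eu n) : Continuous (ch ζ) := by
  unfold ch
  fun_prop

theorem int_ch {n : ℕ} (ζ : Eu n) {g : Eu n → ℂ} (hg : Integrable g) :
    Integrable (fun x => ch ζ x * g x) :=
  hg.bdd_mul (ch_cont ζ).aestronglyMeasurable (c := 1)
    (Filter.Eventually.of_forall fun x => (norm_ch ζ x).le)

theorem ibp {n : ℕ} (ζ : Eu n) {F : Eu n → ℂ} (hF : ContDiff ℝ (⊤ : ℕ∞) F) (w : List (Fin n))
    (hi : ∀ v, v <:+ w → Integrable (DW v F)) :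
    (w.map (fun j => Complex.I * (ζ j : ℂ))).prod * ∫ x, ch ζ x * F x
      = ∫ x, ch ζ x * DW w F x := by
  induction w with
  | nil => simp [DW]
  | cons j w ih =>
    have ih' := ih (fun v hv => hi v (hv.trans (List.suffix_cons j w)))
    rw [List.map_cons, List.prod_cons, mul_assoc, ih', DW_cons]
    have hw : Integrable (DW w F) := hi w (List.suffix_cons j w)
    have hjw : Integrable (pd j (DW w F)) := hi (j :: w) List.suffix_rfl
    have hk : (fun x => fderiv ℝ (ch ζ) x (EuclideanSpace.single j 1) * DW w F x) =
        fun x => -(Complex.I * ζ j) * (ch ζ x * DW w F x) := by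
      funext x; rw [(ch_deriv ζ x j).2, mul_assoc]
    have := integral_mul_fderiv_eq_neg_fderiv_mul_of_integrable (μ := (volume : Measure (Eu n)))
      (f := ch ζ) (g := DW w F) (v := EuclideanSpace.single j (1 : ℝ))
      (by rw [hk]; exact (int_ch ζ hw).const_mul _) (int_ch ζ hjw) (int_ch ζ hw)
      (fun x _ => (ch_deriv ζ x j).1) (fun x _ => sm_diff (DW_smooth w hF) x)
    unfold pd
    rw [this, hk, integral_const_mul]
    ring

theorem int_exp {n : ℕ} (hn : 0 < n) {c p : ℝ} (hc : 0 < c) (hp : 0 < p) :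
    Integrable (fun x : Eu n => Real.exp (-(c * ‖x‖ ^ p))) := by
  have : Nontrivial (Eu n) := by
    have : Nonempty (Fin n) := ⟨⟨0, hn⟩⟩
    infer_instance
  rw [integrable_fun_norm_addHaar (volume : Measure (Eu n))
    (f := fun r => Real.exp (-(c * r ^ p)))]
  have h := integrableOn_rpow_mul_exp_neg_mul_rpow (p := p) (b := c)
    (s := ((Module.finrank ℝ (Eu n) - 1 : ℕ) : ℝ))
    (by have := Nat.cast_nonneg (α := ℝ) (Module.finrank ℝ (Eu n) - 1); linarith) hp hc
  refine h.congr_fun ?_ measurableSet_Ioi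
  intro x _
  simp [Real.rpow_natCast]

theorem rpow_bound {p x y r : ℝ} (hp : 0 < p) (hp2 : p < 2) (hx : 0 ≤ x) (hy : 0 ≤ y)
    (hr : 0 ≤ r) (h : r ≤ x + y) : r ^ p ≤ 2 * (x ^ p + y ^ p) := by
  have h0 : r ^ p ≤ (x + y) ^ p := Real.rpow_le_rpow hr h hp.le
  have hpos : 0 ≤ x ^ p + y ^ p := add_nonneg (Real.rpow_nonneg hx p) (Real.rpow_nonneg hy p)
  rcases le_total p 1 with h1 | h1
  · have := Real.rpow_add_le_add_rpow hx hy hp.le h1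
    linarith
  · lift x to NNReal using hx
    lift y to NNReal using hy
    have h2 : ((x : ℝ) + y) ^ p ≤ 2 ^ (p - 1) * ((x : ℝ) ^ p + (y : ℝ) ^ p) := by
      exact_mod_cast NNReal.rpow_add_le_mul_rpow_add_rpow x y h1
    have h3 : (2 : ℝ) ^ (p - 1) ≤ 2 := by
      calc (2 : ℝ) ^ (p - 1) ≤ 2 ^ (1 : ℝ) :=
            Real.rpow_le_rpow_of_exponent_le (by norm_num) (by linarith)
        _ = 2 := by simp
    nlinarith

theorem norm_list_sum (L : List ℂ) : ‖L.sum‖ ≤ (L.map (fun x => ‖x‖)).sum := by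
  induction L with
  | nil => simp
  | cons a L ih =>
    rw [List.sum_cons, List.map_cons, List.sum_cons]
    exact (norm_add_le _ _).trans (by gcongr)

/-- Product bound for a sorted word. -/
theorem prod_bound {n : ℕ} {f g : Eu n → ℂ} (hf : ContDiff ℝ (⊤ : ℕ∞) f)
    (hg : ContDiff ℝ (⊤ : ℕ∞) g) {s : ℝ} (hs : 0 ≤ s) (x : Eu n) {h k P Q : ℝ}
    (hh : 0 ≤ h) (hk : 0 ≤ k) (hP : 0 ≤ P) (hQ : 0 ≤ Q)
    (bf : ∀ β : Fin n → ℕ, ‖DW (W β) f x‖ ≤ P * h ^ (∑ j, β j) * (∏ j, ((β j)! : ℝ)) ^ s)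
    (bg : ∀ β : Fin n → ℕ, ‖DW (W β) g x‖ ≤ Q * k ^ (∑ j, β j) * (∏ j, ((β j)! : ℝ)) ^ s)
    (α : Fin n → ℕ) :
    ‖DW (W α) (fun x => f x * g x) x‖ ≤
      P * Q * (∏ j, ((α j)! : ℝ)) ^ s * (h + k) ^ (∑ j, α j) := by
  rw [leibniz _ hf hg, ← length_W α, ← splits_sum, ← List.sum_map_mul_left]
  refine (norm_list_sum _).trans ?_
  rw [List.map_map]
  apply List.sum_le_sum
  intro p hp
  obtain ⟨h1, h2, h3⟩ := splits_prop _ p hp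
  have e1 := eq_W p.1 ((sorted_W α).sublist h1)
  have e2 := eq_W p.2 ((sorted_W α).sublist h2)
  have b1 := bf (fun j => p.1.count j)
  have b2 := bg (fun j => p.2.count j)
  rw [← length_W, ← e1] at b1
  rw [← length_W, ← e2] at b2
  have hfac : (∏ j, ((p.1.count j)! : ℝ)) ^ s * (∏ j, ((p.2.count j)! : ℝ)) ^ s
      ≤ (∏ j, ((α j)! : ℝ)) ^ s := by
    rw [← Real.mul_rpow (by positivity) (by positivity), ← Finset.prod_mul_distrib]
    refine Real.rpow_le_rpow (by positivity) ?_ hs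
    refine Finset.prod_le_prod (fun j _ => by positivity) fun j _ => ?_
    have h4 := h3 j
    rw [count_W] at h4
    rw [← h4]
    exact_mod_cast Nat.le_of_dvd (Nat.factorial_pos _) (Nat.factorial_mul_factorial_dvd_factorial_add _ _)
  simp only [Function.comp]
  rw [norm_mul]
  calc ‖DW p.1 f x‖ * ‖DW p.2 g x‖ ≤ _ * _ := mul_le_mul b1 b2 (norm_nonneg _) (by positivity)
    _ = P * Q * ((∏ j, ((p.1.count j)! : ℝ)) ^ s * (∏ j, ((p.2.count j)! : ℝ)) ^ s) *
        (h ^ p.1.length * k ^ p.2.length) := by ring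
    _ ≤ _ := by gcongr

end StftAux

/-- Let `ε > 0`, `d ≥ 1`, `s > 1/2`, `μ > 0`.  Suppose `a_t` (`t ∈ [0, ε]`)
is a family of smooth functions on `ℝ^{2d}` satisfying, for every `h > 0`,
`|∂^α a_t(z)| ≲ h^{|α|} (α!)^s exp(μ h^{−1/s} |z|^{1/s})` uniformly in `t`, and `Φ` is a smooth
Gelfand–Shilov window: for every `A > 0`, `|∂^β Φ(x)| ≲ (β!)^s A^{−|β|} exp(−A|x|^{1/s})`.
Then for all `h₁, h₂ > 0` with `h₂⁻¹ > 2μ h₁^{−1/s}` there is `C > 0` with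
`|ζ^α V_Φ a_t (z, ζ)| ≤ C (α!)^s (h₁+h₂)^{|α|} exp(2μ h₁^{−1/s} |z|^{1/s})` for all `z, ζ, α`
and `t ∈ [0, ε]`. -/
theorem stft_monomial_estimate (d : ℕ) (hd : 1 ≤ d) (ε s μ : ℝ) (hε : 0 < ε)
    (hs : 1 / 2 < s) (hμ : 0 < μ)
    (a : ℝ → EuclideanSpace ℝ (Fin (2 * d)) → ℂ)
    (ha_smooth : ∀ t ∈ Set.Icc (0 : ℝ) ε, ContDiff ℝ (⊤ : ℕ∞) (a t))
    (ha : ∀ h : ℝ, 0 < h → ∃ C : ℝ, 0 < C ∧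
      ∀ t ∈ Set.Icc (0 : ℝ) ε, ∀ (z : EuclideanSpace ℝ (Fin (2 * d))) (α : Fin (2 * d) → ℕ),
        ‖pdMulti α (a t) z‖ ≤
          C * h ^ (∑ j, α j) * (∏ j, ((α j)! : ℝ)) ^ s *
            Real.exp (μ * h ^ (-(1 / s)) * ‖z‖ ^ (1 / s)))
    (Φ : EuclideanSpace ℝ (Fin (2 * d)) → ℂ) (hΦ_smooth : ContDiff ℝ (⊤ : ℕ∞) Φ)
    (hΦ : ∀ A : ℝ, 0 < A → ∃ C : ℝ, 0 < C ∧
      ∀ (β : Fin (2 * d) → ℕ) (x : EuclideanSpace ℝ (Fin (2 * d))),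
        ‖pdMulti β Φ x‖ ≤
          C * (∏ j, ((β j)! : ℝ)) ^ s / A ^ (∑ j, β j) * Real.exp (-(A * ‖x‖ ^ (1 / s)))) :
    ∀ h₁ h₂ : ℝ, 0 < h₁ → 0 < h₂ → h₂⁻¹ > 2 * μ * h₁ ^ (-(1 / s)) →
      ∃ C : ℝ, 0 < C ∧
        ∀ t ∈ Set.Icc (0 : ℝ) ε,
          ∀ (z ζ : EuclideanSpace ℝ (Fin (2 * d))) (α : Fin (2 * d) → ℕ),
            ‖(∏ j, (ζ j : ℂ) ^ (α j)) * stft d Φ (a t) z ζ‖ ≤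
              C * (∏ j, ((α j)! : ℝ)) ^ s * (h₁ + h₂) ^ (∑ j, α j) *
                Real.exp (2 * μ * h₁ ^ (-(1 / s)) * ‖z‖ ^ (1 / s)) := by
  intro h₁ h₂ hh₁ hh₂ hlt
  have hs0 : 0 < s := by linarith
  have hp : 0 < 1 / s := by positivity
  have hp2 : 1 / s < 2 := by rw [div_lt_iff₀ hs0]; linarith
  obtain ⟨C₁, hC₁, B₁⟩ := ha h₁ hh₁
  obtain ⟨C₂, hC₂, B₂⟩ := hΦ h₂⁻¹ (inv_pos.mpr hh₂)
  set m := 2 * μ * h₁ ^ (-(1 / s)) with hm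
  have hm0 : 0 < m := by positivity
  have hc : 0 < h₂⁻¹ - m := by linarith
  have hint := StftAux.int_exp (n := 2 * d) (by omega) hc hp
  set J := ∫ x : EuclideanSpace ℝ (Fin (2 * d)), Real.exp (-((h₂⁻¹ - m) * ‖x‖ ^ (1 / s))) with hJ
  have hJ0 : 0 ≤ J := integral_nonneg fun x => (Real.exp_pos _).le
  refine ⟨((2 * Real.pi) ^ d : ℝ)⁻¹ * (C₁ * C₂ * (J + 1)), by positivity, ?_⟩
  intro t ht z ζ α
  set G : EuclideanSpace ℝ (Fin (2 * d)) → ℂ := fun x => (starRingEnd ℂ) (Φ (x - z)) with hG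
  have hGs := StftAux.conj_trans_smooth hΦ_smooth z
  have has := ha_smooth t ht
  have hFs : ContDiff ℝ (⊤ : ℕ∞) (fun x => a t x * G x) := has.mul hGs
  have key : ∀ (β : Fin (2 * d) → ℕ) (x : EuclideanSpace ℝ (Fin (2 * d))),
      ‖StftAux.DW (StftAux.W β) (fun x => a t x * G x) x‖ ≤
        (C₁ * C₂ * (∏ j, ((β j)! : ℝ)) ^ s * (h₁ + h₂) ^ (∑ j, β j) *
          Real.exp (m * ‖z‖ ^ (1 / s))) *
          Real.exp (-((h₂⁻¹ - m) * ‖x - z‖ ^ (1 / s))) := by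
    intro β x
    have h := StftAux.prod_bound has hGs hs0.le x (h := h₁) (k := h₂)
      (P := C₁ * Real.exp (μ * h₁ ^ (-(1 / s)) * ‖x‖ ^ (1 / s)))
      (Q := C₂ * Real.exp (-(h₂⁻¹ * ‖x - z‖ ^ (1 / s))))
      hh₁.le hh₂.le (by positivity) (by positivity)
      (fun γ => by
        rw [← StftAux.pdMulti_eq]
        refine (B₁ t ht x γ).trans (le_of_eq (by ring)))
      (fun γ => by
        rw [StftAux.DW_conj_trans _ hΦ_smooth, ← StftAux.pdMulti_eq, RCLike.norm_conj]
        refine (B₂ γ (x - z)).trans (le_of_eq ?_)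
        rw [inv_pow, div_inv_eq_mul]; ring) β
    refine h.trans ?_
    have hr := StftAux.rpow_bound hp hp2 (norm_nonneg z) (norm_nonneg (x - z)) (norm_nonneg x)
      (by simpa using norm_add_le z (x - z))
    have hexp : Real.exp (μ * h₁ ^ (-(1 / s)) * ‖x‖ ^ (1 / s)) *
        Real.exp (-(h₂⁻¹ * ‖x - z‖ ^ (1 / s))) ≤ Real.exp (m * ‖z‖ ^ (1 / s)) *
          Real.exp (-((h₂⁻¹ - m) * ‖x - z‖ ^ (1 / s))) := by
      rw [← Real.exp_add, ← Real.exp_add, Real.exp_le_exp]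
      have h5 := mul_le_mul_of_nonneg_left hr (show 0 ≤ μ * h₁ ^ (-(1 / s)) by positivity)
      rw [hm]
      linarith
    calc _ = (C₁ * C₂ * (∏ j, ((β j)! : ℝ)) ^ s * (h₁ + h₂) ^ (∑ j, β j)) *
          (Real.exp (μ * h₁ ^ (-(1 / s)) * ‖x‖ ^ (1 / s)) *
            Real.exp (-(h₂⁻¹ * ‖x - z‖ ^ (1 / s)))) := by ring
      _ ≤ _ := mul_le_mul_of_nonneg_left hexp (by positivity)
      _ = _ := by ring
  have hint' : Integrable (fun x : EuclideanSpace ℝ (Fin (2 * d)) =>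
      Real.exp (-((h₂⁻¹ - m) * ‖x - z‖ ^ (1 / s)))) := hint.comp_sub_right z
  have hDint : ∀ v, v <:+ StftAux.W α →
      Integrable (StftAux.DW v (fun x => a t x * G x)) := by
    intro v hv
    rw [StftAux.eq_W v ((StftAux.sorted_W α).sublist hv.sublist)]
    refine Integrable.mono' (hint'.const_mul _)
      (StftAux.DW_smooth _ hFs).continuous.aestronglyMeasurable
      (Filter.Eventually.of_forall fun x => key _ x)
  have hibp := StftAux.ibp ζ hFs (StftAux.W α) hDint
  rw [StftAux.prod_W] at hibp
  have hst : stft d Φ (a t) z ζ = (((2 * Real.pi) ^ d : ℝ)⁻¹ : ℂ) *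
      ∫ x, StftAux.ch ζ x * (a t x * G x) := by
    unfold stft
    congr 2
    funext x
    simp only [hG, StftAux.ch]
    ring
  have hnorm : ‖∏ j, (ζ j : ℂ) ^ (α j)‖ = ‖∏ j, (Complex.I * (ζ j : ℂ)) ^ (α j)‖ := by
    simp [norm_prod]
  have hcst : ‖(((2 * Real.pi) ^ d : ℝ)⁻¹ : ℂ)‖ = ((2 * Real.pi) ^ d : ℝ)⁻¹ := by
    rw [norm_inv, Complex.norm_real, Real.norm_of_nonneg (by positivity)]
  have hI : ‖∫ x, StftAux.ch ζ x * StftAux.DW (StftAux.W α) (fun x => a t x * G x) x‖ ≤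
      (C₁ * C₂ * (∏ j, ((α j)! : ℝ)) ^ s * (h₁ + h₂) ^ (∑ j, α j) *
          Real.exp (m * ‖z‖ ^ (1 / s))) * J := by
    have := norm_integral_le_of_norm_le (hint'.const_mul (C₁ * C₂ * (∏ j, ((α j)! : ℝ)) ^ s *
      (h₁ + h₂) ^ (∑ j, α j) * Real.exp (m * ‖z‖ ^ (1 / s))))
      (f := fun x => StftAux.ch ζ x * StftAux.DW (StftAux.W α) (fun x => a t x * G x) x)
      (Filter.Eventually.of_forall fun x => by
        rw [norm_mul, StftAux.norm_ch, one_mul]; exact key α x)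
    refine this.trans (le_of_eq ?_)
    rw [integral_const_mul]
    congr 1
    exact integral_sub_right_eq_self
      (fun x : EuclideanSpace ℝ (Fin (2 * d)) => Real.exp (-((h₂⁻¹ - m) * ‖x‖ ^ (1 / s)))) z
  calc _ = ((2 * Real.pi) ^ d : ℝ)⁻¹ *
        ‖∫ x, StftAux.ch ζ x * StftAux.DW (StftAux.W α) (fun x => a t x * G x) x‖ := by
        rw [hst, ← hibp, norm_mul, norm_mul, norm_mul, hnorm, hcst]; ring
    _ ≤ ((2 * Real.pi) ^ d : ℝ)⁻¹ * ((C₁ * C₂ * (∏ j, ((α j)! : ℝ)) ^ s *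
          (h₁ + h₂) ^ (∑ j, α j) * Real.exp (m * ‖z‖ ^ (1 / s))) * (J + 1)) := by
        gcongr
        refine hI.trans ?_
        gcongr
        linarith
    _ = _ := by ring
end

section
/- Let d ≥ 1, s > 1/2, and let B be a set of smooth functions ℝ^d → ℂ such that sup_{f∈B} ‖f‖_{𝒮_{s,h}} < ∞ for every h > 0. Then for every ε > 0 there exist finitely many functions φ_1, …, φ_K ∈ L²(ℝ^d) such that B ⊆ ⋃_{j=1}^K { f : ‖f − φ_j‖_{L²(ℝ^d)} < ε }; that is, B is totally bounded with respect to the L² norm. -/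
open scoped Nat ENNReal
open MeasureTheory

/-- The Gelfand–Shilov seminorm `‖f‖_{𝒮_{s,h}} = sup_{α,β,x} |x^α ∂^β f(x)| / (h^{|α+β|}(α!β!)^s)`,
with value in `ℝ≥0∞` (so it is `∞` when the supremum is not finite). -/
noncomputable def gsSeminorm {d : ℕ} (s h : ℝ) (f : EuclideanSpace ℝ (Fin d) → ℂ) : ℝ≥0∞ :=
  ⨆ (α : Fin d → ℕ) (β : Fin d → ℕ) (x : EuclideanSpace ℝ (Fin d)),
    ENNReal.ofReal (‖(∏ j, (x j : ℂ) ^ (α j)) * pdMulti β f x‖ /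
      (h ^ (∑ j, α j + ∑ j, β j) * ((∏ j, ((α j)! : ℝ)) * ∏ j, ((β j)! : ℝ)) ^ s))


section helpers

theorem foldr_single_aux {n : ℕ} (j : Fin n) (f : EuclideanSpace ℝ (Fin n) → ℂ)
    (l : List (Fin n)) (hl : l.Nodup) :
    l.foldr (fun i g => (pd i)^[(Pi.single j 1 : Fin n → ℕ) i] g) f =
      if j ∈ l then pd j f else f := by
  induction l with
  | nil => simp
  | cons a l ih =>
    rw [List.nodup_cons] at hl
    rw [List.foldr_cons, ih hl.2]
    by_cases h : a = j
    · subst h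
      simp [hl.1]
    · have h' : ¬ j = a := fun e => h e.symm
      simp [h, h']

theorem pdMulti_single_aux {n : ℕ} (j : Fin n) (f : EuclideanSpace ℝ (Fin n) → ℂ) :
    pdMulti (Pi.single j 1) f = pd j f := by
  unfold pdMulti
  rw [foldr_single_aux j f _ (List.nodup_finRange n)]
  simp

theorem pdMulti_zero_aux {n : ℕ} (f : EuclideanSpace ℝ (Fin n) → ℂ) :
    pdMulti 0 f = f := by
  unfold pdMulti
  induction (List.finRange n) with
  | nil => rfl
  | cons a l ih => simpa using ih

theorem bound_aux {d : ℕ} {s : ℝ} {B : Set (EuclideanSpace ℝ (Fin d) → ℂ)}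
    (hbdd : (⨆ f ∈ B, gsSeminorm s 1 f) < ⊤) (α β : Fin d → ℕ) :
    ∃ C : ℝ, 0 ≤ C ∧ ∀ f ∈ B, ∀ x : EuclideanSpace ℝ (Fin d),
      (∏ j, |x j| ^ (α j)) * ‖pdMulti β f x‖ ≤ C := by
  set D : ℝ := ((∏ j, ((α j)! : ℝ)) * ∏ j, ((β j)! : ℝ)) ^ s with hD
  have hDpos : 0 < D := by
    apply Real.rpow_pos_of_pos
    apply mul_pos <;> exact Finset.prod_pos fun j _ => by positivity
  refine ⟨(⨆ f ∈ B, gsSeminorm s 1 f).toReal * D, by positivity, fun f hf x => ?_⟩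
  rw [← div_le_iff₀ hDpos]
  have h1 : gsSeminorm s 1 f ≤ ⨆ f ∈ B, gsSeminorm s 1 f := le_iSup₂_of_le f hf le_rfl
  have h2 : ENNReal.ofReal (((∏ j, |x j| ^ (α j)) * ‖pdMulti β f x‖) / D) ≤ gsSeminorm s 1 f := by
    unfold gsSeminorm
    refine le_iSup_of_le α (le_iSup_of_le β (le_iSup_of_le x ?_))
    simp [hD, norm_prod]
  exact (ENNReal.ofReal_le_iff_le_toReal hbdd.ne).1 (h2.trans h1)

theorem decay_aux {d : ℕ} (hd : 1 ≤ d) {s : ℝ} {B : Set (EuclideanSpace ℝ (Fin d) → ℂ)}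
    (hbdd : (⨆ f ∈ B, gsSeminorm s 1 f) < ⊤) (M : ℕ) :
    ∃ C : ℝ, 0 ≤ C ∧ ∀ f ∈ B, ∀ x : EuclideanSpace ℝ (Fin d),
      (1 + ‖x‖) ^ M * ‖f x‖ ≤ C := by
  obtain ⟨C0, hC0, h0⟩ := bound_aux hbdd 0 0
  choose C hC hb using fun j : Fin d => bound_aux hbdd (Pi.single j M) 0
  refine ⟨2 ^ (M - 1) * (C0 + d ^ M * ∑ j, C j), by
    have := Finset.sum_nonneg fun j (_ : j ∈ Finset.univ) => hC j
    positivity, fun f hf x => ?_⟩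
  have : Nonempty (Fin d) := ⟨⟨0, hd⟩⟩
  obtain ⟨j, hj⟩ := Finite.exists_max fun j => |x j|
  have hx : ‖x‖ ≤ d * |x j| := by
    have h1 : ‖x‖ ≤ ∑ i, |x i| := by
      rw [EuclideanSpace.norm_eq]
      apply Real.sqrt_le_iff.2
      refine ⟨Finset.sum_nonneg fun i _ => abs_nonneg _, ?_⟩
      simpa using Finset.sum_sq_le_sq_sum_of_nonneg (s := Finset.univ) (f := fun i => |x i|)
        fun i _ => abs_nonneg _
    refine h1.trans ?_
    calc ∑ i, |x i| ≤ ∑ i : Fin d, |x j| := Finset.sum_le_sum fun i _ => hj i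
      _ = _ := by simp
  have hf0 : ‖f x‖ ≤ C0 := by simpa [pdMulti_zero_aux] using h0 f hf x
  have hfj : |x j| ^ M * ‖f x‖ ≤ ∑ j, C j := by
    have h1 : (∏ i, |x i| ^ ((Pi.single j M : Fin d → ℕ) i)) = |x j| ^ M := by
      rw [Finset.prod_eq_single j]
      · simp
      · intro b _ hbj
        simp [hbj]
      · simp
    have h2 := hb j f hf x
    rw [h1, pdMulti_zero_aux] at h2
    exact h2.trans (Finset.single_le_sum (f := C) (fun i _ => hC i) (Finset.mem_univ j))
  calc (1 + ‖x‖) ^ M * ‖f x‖ ≤ (1 + d * |x j|) ^ M * ‖f x‖ := by gcongr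
    _ ≤ (2 ^ (M - 1) * (1 ^ M + (d * |x j|) ^ M)) * ‖f x‖ := by
        gcongr
        exact add_pow_le (by positivity) (by positivity) M
    _ = 2 ^ (M - 1) * (‖f x‖ + d ^ M * (|x j| ^ M * ‖f x‖)) := by
        rw [mul_pow]; ring
    _ ≤ _ := by gcongr

theorem lip_aux {d : ℕ} {s : ℝ} {B : Set (EuclideanSpace ℝ (Fin d) → ℂ)}
    (hsm : ∀ f ∈ B, ContDiff ℝ (⊤ : ℕ∞) f)
    (hbdd : (⨆ f ∈ B, gsSeminorm s 1 f) < ⊤) :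
    ∃ C : NNReal, ∀ f ∈ B, LipschitzWith C f := by
  choose C hC hb using fun j : Fin d => bound_aux hbdd 0 (Pi.single j 1)
  have hS : 0 ≤ ∑ j, C j := Finset.sum_nonneg fun j _ => hC j
  refine ⟨(∑ j, C j).toNNReal, fun f hf => ?_⟩
  apply lipschitzWith_of_nnnorm_fderiv_le (𝕜 := ℝ) ((hsm f hf).differentiable (by simp))
  intro x
  rw [← NNReal.coe_le_coe, Real.coe_toNNReal _ hS]
  refine ContinuousLinearMap.opNorm_le_bound _ hS fun v => ?_
  have hv : v = ∑ j, v j • EuclideanSpace.single j (1 : ℝ) := by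
    ext i
    simp [Finset.sum_apply, Pi.single_apply]
  have h1 : fderiv ℝ f x v = ∑ j, v j • pd j f x := by
    conv_lhs => rw [hv]
    simp only [map_sum, map_smul, pd]
  rw [h1]
  change _ ≤ (∑ j, C j) * ‖v‖
  rw [Finset.sum_mul]
  refine (norm_sum_le _ _).trans (Finset.sum_le_sum fun j _ => ?_)
  rw [norm_smul, mul_comm]
  have h2 := hb j f hf x
  rw [pdMulti_single_aux] at h2
  simp only [Pi.zero_apply, pow_zero, Finset.prod_const_one, one_mul] at h2
  exact mul_le_mul h2 (PiLp.norm_apply_le v j) (norm_nonneg _) (hC j)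

theorem net_aux {d : ℕ} {B : Set (EuclideanSpace ℝ (Fin d) → ℂ)} {L : NNReal} {C : ℝ}
    (hL : ∀ f ∈ B, LipschitzWith L f) (hC : ∀ f ∈ B, ∀ x, ‖f x‖ ≤ C) (R δ : ℝ) (hδ : 0 < δ) :
    ∃ t : Set (EuclideanSpace ℝ (Fin d) → ℂ), t.Finite ∧ t ⊆ B ∧
      ∀ f ∈ B, ∃ g ∈ t, ∀ x, ‖x‖ ≤ R → ‖f x - g x‖ ≤ δ := by
  classical
  rcases B.eq_empty_or_nonempty with hB | hB
  · exact ⟨∅, Set.finite_empty, Set.empty_subset _, by simp [hB]⟩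
  have hne : Nonempty B := hB.to_subtype
  let K := Metric.closedBall (0 : EuclideanSpace ℝ (Fin d)) R
  have : CompactSpace K := isCompact_iff_compactSpace.1 (isCompact_closedBall _ _)
  let r : B → BoundedContinuousFunction K ℂ := fun f =>
    BoundedContinuousFunction.mkOfCompact
      ⟨fun x : K => f.1 x, (hL f.1 f.2).continuous.comp continuous_subtype_val⟩
  have hcomp : IsCompact (closure (Set.range r)) := by
    apply BoundedContinuousFunction.arzela_ascoli (Metric.closedBall (0 : ℂ) C)
      (isCompact_closedBall _ _)
    · rintro _ x ⟨f, rfl⟩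
      simpa [r] using hC f.1 f.2 x
    · apply LipschitzWith.uniformEquicontinuous _ L _ |>.equicontinuous
      rintro ⟨_, ⟨f, rfl⟩⟩
      exact (hL f.1 f.2).comp (LipschitzWith.subtype_val _) |>.weaken (by simp)
  have htb : TotallyBounded (Set.range r) := hcomp.totallyBounded.subset subset_closure
  obtain ⟨t, ht, htf, hcov⟩ := Metric.finite_approx_of_totallyBounded htb δ hδ
  choose! q hq using fun u (hu : u ∈ t) => ht hu
  refine ⟨(fun u => (q u).1) '' t, htf.image _, ?_, fun f hf => ?_⟩
  · rintro _ ⟨u, _, rfl⟩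
    exact (q u).2
  · have h1 := hcov ⟨⟨f, hf⟩, rfl⟩
    simp only [Set.mem_iUnion] at h1
    obtain ⟨u, hu, hfu⟩ := h1
    refine ⟨_, ⟨u, hu, rfl⟩, fun x hx => ?_⟩
    rw [← hq u hu, Metric.mem_ball] at hfu
    have h2 := (BoundedContinuousFunction.dist_coe_le_dist
      (f := r ⟨f, hf⟩) (g := r (q u)) ⟨x, by simpa [K] using hx⟩).trans hfu.le
    rw [dist_eq_norm] at h2
    exact h2

end helpers

/-- Let `d ≥ 1`, `s > 1/2` and let `B` be a set of smooth functions on `ℝ^d`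
with `sup_{f ∈ B} ‖f‖_{𝒮_{s,h}} < ∞` for every `h > 0`.  Then for every `ε > 0` there are
finitely many `g_1, …, g_K ∈ L²(ℝ^d)` such that every `f ∈ B` lies within L²-distance `ε` of
some `g_j`; that is, `B` is totally bounded with respect to the `L²` norm. -/
theorem gs_bounded_totallyBounded_L2 (d : ℕ) (hd : 1 ≤ d) (s : ℝ) (hs : 1 / 2 < s)
    (B : Set (EuclideanSpace ℝ (Fin d) → ℂ)) (hsm : ∀ f ∈ B, ContDiff ℝ (⊤ : ℕ∞) f)
    (hbdd : ∀ h : ℝ, 0 < h → (⨆ f ∈ B, gsSeminorm s h f) < ⊤) :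
    ∀ ε : ℝ, 0 < ε → ∃ (K : ℕ) (g : Fin K → (EuclideanSpace ℝ (Fin d) → ℂ)),
      (∀ j : Fin K, MemLp (g j) 2 volume) ∧
        ∀ f ∈ B, ∃ j : Fin K,
          eLpNorm (fun x => f x - g j x) 2 volume < ENNReal.ofReal ε := by
  intro ε hε
  have hb := hbdd 1 one_pos
  obtain ⟨L, hL⟩ := lip_aux hsm hb
  obtain ⟨C0, hC0, hdec0⟩ := decay_aux hd hb 0
  obtain ⟨C, hC, hdec⟩ := decay_aux hd hb (d + 2)
  set w : EuclideanSpace ℝ (Fin d) → ℝ := fun x => ((1 + ‖x‖) ^ (d + 1))⁻¹ with hw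
  have hwpos : ∀ x, 0 < w x := fun x => by simp only [hw]; positivity
  have hwc : Continuous w := by
    refine Continuous.inv₀ (by fun_prop) fun x => ?_
    positivity
  have hw2 : MemLp w 2 volume := by
    rw [memLp_two_iff_integrable_sq hwc.aestronglyMeasurable]
    have h1 := integrable_one_add_norm (E := EuclideanSpace ℝ (Fin d)) (μ := volume)
      (r := ((2 * (d + 1) : ℕ) : ℝ)) (by simp; linarith)
    refine h1.congr (Filter.Eventually.of_forall fun x => ?_)
    simp only [hw]
    rw [Real.rpow_neg (by positivity), Real.rpow_natCast, inv_pow, ← pow_mul, mul_comm 2]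
  set W := (eLpNorm w 2 volume).toReal with hW
  have hW0 : 0 ≤ W := ENNReal.toReal_nonneg
  set η := ε / (W + 1) with hη
  have hηpos : 0 < η := by positivity
  -- uniform decay in terms of the weight
  have hdec' : ∀ f ∈ B, ∀ x, ‖f x‖ ≤ C * w x / (1 + ‖x‖) := by
    intro f hf x
    have h1 := hdec f hf x
    have hp : 0 < 1 + ‖x‖ := by positivity
    simp only [hw]
    rw [← div_eq_mul_inv, div_div, ← pow_succ, le_div_iff₀ (by positivity)]
    linarith
  obtain ⟨R, hR0, hR⟩ : ∃ R : ℝ, 0 ≤ R ∧ 2 * C ≤ η * (1 + R) := by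
    refine ⟨2 * C / η, by positivity, ?_⟩
    have : η * (1 + 2 * C / η) = η + 2 * C := by field_simp
    linarith
  have hδ : 0 < η * ((1 + R) ^ (d + 1))⁻¹ := by positivity
  obtain ⟨t, htf, htB, hcov⟩ := net_aux hL (C := C0)
    (fun f hf x => by simpa using hdec0 f hf x) R _ hδ
  have hfin : Fintype t := htf.fintype
  let e := Fintype.equivFin t
  refine ⟨Fintype.card t, fun j => (e.symm j).1, fun j => ?_, fun f hf => ?_⟩
  · have hg := htB (e.symm j).2
    refine MemLp.of_le (hw2.const_mul C) (hL _ hg).continuous.aestronglyMeasurable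
      (Filter.Eventually.of_forall fun x => ?_)
    refine (hdec' _ hg x).trans (le_trans ?_ (le_abs_self _))
    exact div_le_self (mul_nonneg hC (hwpos x).le) (by linarith [norm_nonneg x])
  · obtain ⟨g, hgt, hg⟩ := hcov f hf
    refine ⟨e ⟨g, hgt⟩, ?_⟩
    simp only [Equiv.symm_apply_apply]
    have hpt : ∀ x, ‖f x - g x‖ ≤ η * w x := by
      intro x
      rcases le_total ‖x‖ R with hx | hx
      · refine (hg x hx).trans ?_
        simp only [hw]
        gcongr
      · have hp : 0 < 1 + ‖x‖ := by positivity
        calc ‖f x - g x‖ ≤ ‖f x‖ + ‖g x‖ := norm_sub_le _ _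
          _ ≤ C * w x / (1 + ‖x‖) + C * w x / (1 + ‖x‖) :=
            add_le_add (hdec' f hf x) (hdec' g (htB hgt) x)
          _ = (2 * C) * w x / (1 + ‖x‖) := by ring
          _ ≤ η * w x := by
            rw [div_le_iff₀ hp]
            have : 2 * C ≤ η * (1 + ‖x‖) := hR.trans (by gcongr)
            nlinarith [hwpos x, mul_le_mul_of_nonneg_right this (hwpos x).le]
    have h1 : eLpNorm (fun x => f x - g x) 2 volume ≤ eLpNorm (η • w) 2 volume :=
      eLpNorm_mono_real fun x => by simpa using hpt x
    refine h1.trans_lt ?_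
    rw [eLpNorm_const_smul, ← ENNReal.ofReal_toReal hw2.eLpNorm_ne_top, ← hW,
      Real.enorm_eq_ofReal hηpos.le, ← ENNReal.ofReal_mul hηpos.le]
    refine (ENNReal.ofReal_lt_ofReal_iff hε).2 ?_
    rw [hη, div_mul_eq_mul_div, div_lt_iff₀ (by positivity)]
    nlinarith
end
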